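/- Let D be a DAG on a finite index set I with finite value types, and let p be a positive joint pmf that is Markov compatible with and faithful to D. Let X, Y ∈ I be distinct, let T ⊆ I \ {X, Y}, suppose X is not an ancestor of any vertex of T in D, and suppose T is an adjustment set relative to ({X}, {Y}) in D. Then T is a minimal adjustment set relative to ({X}, {Y}) in D if and only if for every T ∈ T, under p: (i) X and T are NOT conditionally independent given T \ {T}, and (ii) Y and T are NOT conditionally independent given (T \ {T}) ∪ {X}. -/

import Mathlib

open scoped Classical

variable {V : Type*}

/-- `a` is an ancestor of `b` (every vertex is its own ancestor). -/
def Anc (E : V → V → Prop) (a b : V) : Prop := Relation.ReflTransGen E a b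

/-- A path in a directed graph `E` from `a` to `b`: a sequence of distinct vertices
`a = vtx 0, …, vtx len = b` (`len ≥ 1`) in which consecutive vertices are joined
by an edge of `E` in either direction. -/
structure GPath (E : V → V → Prop) (a b : V) where
  len : ℕ
  len_pos : 0 < len
  vtx : ℕ → V
  first : vtx 0 = a
  last : vtx len = b
  inj : ∀ i j, i ≤ len → j ≤ len → vtx i = vtx j → i = j
  adj : ∀ i, i < len → E (vtx i) (vtx (i + 1)) ∨ E (vtx (i + 1)) (vtx i)

namespace GPath

variable {E : V → V → Prop} {a b : V}

/-- The interior vertex at position `i` is a collider on the path. -/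
def IsColliderAt (p : GPath E a b) (i : ℕ) : Prop :=
  0 < i ∧ i < p.len ∧ E (p.vtx (i - 1)) (p.vtx i) ∧ E (p.vtx (i + 1)) (p.vtx i)

/-- A path is open given `S` if no non-collider on it lies in `S` and every collider
on it has a descendant in `S`. -/
def OpenGiven (p : GPath E a b) (S : Set V) : Prop :=
  (∀ i, 0 < i → i < p.len → ¬ p.IsColliderAt i → p.vtx i ∉ S) ∧
  (∀ i, p.IsColliderAt i → ∃ d ∈ S, Anc E (p.vtx i) d)

/-- A back-door path: the first edge points into the first vertex. -/
def IsBackdoor (p : GPath E a b) : Prop := E (p.vtx 1) (p.vtx 0)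

/-- A causal (directed) path. -/
def Causal (p : GPath E a b) : Prop := ∀ i, i < p.len → E (p.vtx i) (p.vtx (i + 1))

/-- A path is proper with respect to `X` if only its first vertex lies in `X`. -/
def ProperFrom (p : GPath E a b) (X : Set V) : Prop :=
  ∀ i, 0 < i → i ≤ p.len → p.vtx i ∉ X

/-- The vertex `w` lies on the path. -/
def MemV (p : GPath E a b) (w : V) : Prop := ∃ i ≤ p.len, p.vtx i = w

/-- The number of colliders on the path. -/
noncomputable def numColliders (p : GPath E a b) : ℕ := Set.ncard {i | p.IsColliderAt i}

end GPath

/-- `A` and `B` are d-separated given `S`: every path from `A` to `B` is blocked given `S`. -/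
def DSep (E : V → V → Prop) (A B S : Set V) : Prop :=
  ∀ a ∈ A, ∀ b ∈ B, ∀ p : GPath E a b, ¬ p.OpenGiven S

/-- `A` and `B` are d-connected given `S`: some path from `A` to `B` is open given `S`. -/
def DConn (E : V → V → Prop) (A B S : Set V) : Prop :=
  ∃ a ∈ A, ∃ b ∈ B, ∃ p : GPath E a b, p.OpenGiven S

/-- The set of descendants of a vertex set `S`. -/
def descendants (E : V → V → Prop) (S : Set V) : Set V := {d | ∃ s ∈ S, Anc E s d}

/-- `S` blocks every back-door path from `x` to `y`. -/
def BlocksBackdoor (E : V → V → Prop) (x y : V) (S : Set V) : Prop :=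
  ∀ p : GPath E x y, p.IsBackdoor → ¬ p.OpenGiven S

/-- The back-door criterion for `Z` relative to `(X, Y)`. -/
def BackdoorCriterion (E : V → V → Prop) (X Y Z : Set V) : Prop :=
  Z ∩ descendants E X = ∅ ∧
  ∀ x ∈ X, ∀ y ∈ Y, BlocksBackdoor E x y (Z ∪ (X \ {x}))

/-- The adjustment criterion for `Z` relative to `(X, Y)`: (a) `Z` contains no
descendant of any `w ∉ X` lying on a proper causal path from `X` to `Y`, and
(b) `Z` blocks every proper non-causal path from `X` to `Y`. -/
def AdjustmentCriterion (E : V → V → Prop) (X Y Z : Set V) : Prop :=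
  (∀ w, w ∉ X →
      (∃ x ∈ X, ∃ y ∈ Y, ∃ p : GPath E x y, p.ProperFrom X ∧ p.Causal ∧ p.MemV w) →
      ∀ z ∈ Z, ¬ Anc E w z) ∧
  (∀ x ∈ X, ∀ y ∈ Y, ∀ p : GPath E x y, p.ProperFrom X → ¬ p.Causal → ¬ p.OpenGiven Z)

variable {I : Type*} [Fintype I] {α : I → Type*} [∀ i, Fintype (α i)] [∀ i, Nonempty (α i)]

/-- The marginal probability, under the joint pmf `p`, that the coordinates in `S`
take the values `x` assigns them. -/
noncomputable def prS (p : (∀ i, α i) → ℝ) (S : Set I) (x : ∀ i, α i) : ℝ :=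
  ∑ᶠ v ∈ {v : ∀ i, α i | ∀ i ∈ S, v i = x i}, p v

/-- `p` is a joint probability mass function. -/
def IsPMF (p : (∀ i, α i) → ℝ) : Prop := (∀ v, 0 ≤ p v) ∧ ∑ᶠ v, p v = 1

/-- The conditional probability of the assignment `x` on `A` given its values on `S`. -/
noncomputable def condPr (p : (∀ i, α i) → ℝ) (A S : Set I) (x : ∀ i, α i) : ℝ :=
  prS p (A ∪ S) x / prS p S x

/-- Conditional independence `A ⫫ B | S` under `p`. -/
def CondIndep (p : (∀ i, α i) → ℝ) (A B S : Set I) : Prop :=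
  ∀ x : ∀ i, α i, condPr p (A ∪ B) S x = condPr p A S x * condPr p B S x

/-- `p` is Markov compatible with the DAG `E`: it factorizes along parents. -/
def MarkovCompat (p : (∀ i, α i) → ℝ) (E : I → I → Prop) : Prop :=
  ∀ v, p v = ∏ᶠ i, condPr p {i} {j | E j i} v

/-- `p` is faithful to `E`: conditional independence holds exactly for d-separations. -/
def Faithful (p : (∀ i, α i) → ℝ) (E : I → I → Prop) : Prop :=
  ∀ A B S : Set I, Disjoint A B → Disjoint S (A ∪ B) →
    (CondIndep p A B S ↔ DSep E A B S)

/-- The interventional pmf `p(v | do(x))` (the truncated factorization). -/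
noncomputable def doPMF (p : (∀ i, α i) → ℝ) (E : I → I → Prop) (X : Set I)
    (x v : ∀ i, α i) : ℝ :=
  if ∀ i ∈ X, v i = x i then ∏ᶠ i ∈ Xᶜ, condPr p {i} {j | E j i} v else 0

/-- Combine the assignment `x` on `X`, the partial assignment `z` on `Z`, and the
assignment `y` elsewhere into one full assignment. -/
noncomputable def mergeVals (X Z : Set I) (x : ∀ i, α i) (z : ∀ j : Z, α j.1)
    (y : ∀ i, α i) : ∀ i, α i :=
  fun i => if h : i ∈ Z then z ⟨i, h⟩ else if i ∈ X then x i else y i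

/-- `Z` is an adjustment set relative to `(X, Y)` in the DAG `E`: for every positive
pmf `q` that is Markov compatible with `E` and all value assignments `x`, `y`,
the interventional probability of `y` on `Y` under `do(x)` equals
`∑ z, q(y | x, z) · q(z)`. -/
def IsAdjustmentSet (E : I → I → Prop) (X Y Z : Set I) : Prop :=
  ∀ q : (∀ i, α i) → ℝ, IsPMF q → (∀ v, 0 < q v) → MarkovCompat q E →
    ∀ x y : ∀ i, α i,
      (∑ᶠ v ∈ {v : ∀ i, α i | ∀ i ∈ Y, v i = y i}, doPMF q E X x v) =
      ∑ᶠ z : (∀ j : Z, α j.1),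
        condPr q Y (X ∪ Z) (mergeVals X Z x z y) * prS q Z (mergeVals X Z x z y)

/-- `Z` is a minimal adjustment set relative to `(X, Y)`: it is an adjustment set
and no proper subset of it is. -/
def MinimalAdjustmentSet (E : I → I → Prop) (X Y Z : Set I) : Prop :=
  IsAdjustmentSet (α := α) E X Y Z ∧ ∀ Z', Z' ⊂ Z → ¬ IsAdjustmentSet (α := α) E X Y Z'


set_option linter.unusedSectionVars false
set_option linter.deprecated false

section PrS

lemma prS_eq_sum (p : (∀ i, α i) → ℝ) (S : Set I) (x : ∀ i, α i) :
    prS p S x = ∑ v : (∀ i, α i), if (∀ i ∈ S, v i = x i) then p v else 0 := by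
  unfold prS
  rw [finsum_eq_sum_of_fintype]
  refine Finset.sum_congr rfl fun v _ => ?_
  rw [finsum_eq_if]
  rfl

lemma prS_congr (p : (∀ i, α i) → ℝ) {S : Set I} {x y : ∀ i, α i}
    (h : ∀ i ∈ S, x i = y i) : prS p S x = prS p S y := by
  rw [prS_eq_sum, prS_eq_sum]
  refine Finset.sum_congr rfl fun v _ => ?_
  have : (∀ i ∈ S, v i = x i) ↔ (∀ i ∈ S, v i = y i) :=
    forall₂_congr fun i hi => by rw [h i hi]
  simp only [this]

lemma prS_congr_fun {p q : (∀ i, α i) → ℝ} {S : Set I} {x : ∀ i, α i}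
    (h : ∀ v, (∀ i ∈ S, v i = x i) → p v = q v) : prS p S x = prS q S x := by
  rw [prS_eq_sum, prS_eq_sum]
  refine Finset.sum_congr rfl fun v _ => ?_
  split_ifs with hv
  · exact h v hv
  · rfl

lemma prS_tower (p : (∀ i, α i) → ℝ) {U Z : Set I} (hd : ∀ i ∈ U, i ∉ Z) (y : ∀ i, α i) :
    prS (fun v => prS p (U ∪ Z) v) Zᶜ y = prS p U y := by
  rw [prS_eq_sum, prS_eq_sum]
  have h1 : ∀ v : (∀ i, α i), (if (∀ i ∈ Zᶜ, v i = y i) then prS p (U ∪ Z) v else 0)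
      = ∑ u : (∀ i, α i), if v = (fun i => if i ∈ Z then u i else y i) then
          (if (∀ i ∈ U, u i = y i) then p u else 0) else 0 := by
    intro v
    rw [prS_eq_sum]
    split_ifs with hv
    · refine Finset.sum_congr rfl fun u _ => ?_
      by_cases h : v = (fun i => if i ∈ Z then u i else y i)
      · rw [if_pos h]
        have : (∀ i ∈ U ∪ Z, u i = v i) ↔ (∀ i ∈ U, u i = y i) := by
          constructor
          · intro h' i hi
            rw [h' i (Or.inl hi), hv i (hd i hi)]
          · rintro h' i (hi | hi)
            · rw [h' i hi, hv i (hd i hi)]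
            · rw [h]; simp [hi]
        simp only [this]
      · rw [if_neg h, if_neg]
        intro h'
        apply h
        funext i
        by_cases hi : i ∈ Z
        · simp [hi, h' i (Or.inr hi)]
        · simp [hi, hv i hi]
    · symm
      refine Finset.sum_eq_zero fun u _ => ?_
      rw [if_neg]
      rintro rfl
      apply hv
      intro i hi
      simp [show i ∉ Z from hi]
  have h2 := Finset.sum_congr (rfl : (Finset.univ : Finset (∀ i, α i)) = Finset.univ) fun v _ => h1 v
  rw [Finset.sum_comm] at h2
  refine Eq.trans (by congr!) (h2.trans ?_)
  refine Finset.sum_congr rfl fun u _ => ?_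
  simp

lemma prS_tower' (p : (∀ i, α i) → ℝ) {U W : Set I} (h : U ⊆ W) (y : ∀ i, α i) :
    prS p U y = prS (fun v => prS p W v) (W \ U)ᶜ y := by
  rw [← prS_tower p (U := U) (Z := W \ U) (fun i hi h => h.2 hi) y]
  rw [Set.union_sdiff_cancel h]

lemma prS_step (p : (∀ i, α i) → ℝ) {U : Set I} {k : I} (hk : k ∉ U) (x : ∀ i, α i) :
    prS p U x = ∑ a : α k, prS p (insert k U) (Function.update x k a) := by
  simp_rw [prS_eq_sum]
  rw [Finset.sum_comm]
  refine Finset.sum_congr rfl fun v _ => ?_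
  have : ∀ a : α k, (∀ i ∈ insert k U, v i = Function.update x k a i) ↔
      (a = v k ∧ ∀ i ∈ U, v i = x i) := by
    intro a
    constructor
    · intro h
      refine ⟨?_, fun i hi => ?_⟩
      · have := h k (Or.inl rfl); simp at this; exact this.symm
      · have := h i (Or.inr hi)
        rwa [Function.update_of_ne (by rintro rfl; exact hk hi)] at this
    · rintro ⟨rfl, h⟩ i (rfl | hi)
      · simp
      · rw [Function.update_of_ne (by rintro rfl; exact hk hi)]; exact h i hi
  simp only [this, ite_and]
  simp

lemma prS_univ (p : (∀ i, α i) → ℝ) (x : ∀ i, α i) : prS p Set.univ x = p x := by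
  rw [prS_eq_sum]
  have : ∀ v : (∀ i, α i), (∀ i ∈ (Set.univ : Set I), v i = x i) ↔ v = x := by
    intro v; simp [funext_iff]
  simp only [this]
  simp

lemma prS_empty (p : (∀ i, α i) → ℝ) (x : ∀ i, α i) : prS p ∅ x = ∑ v, p v := by
  rw [prS_eq_sum]
  simp

lemma prS_pos {p : (∀ i, α i) → ℝ} (hp : ∀ v, 0 < p v) (S : Set I) (x : ∀ i, α i) :
    0 < prS p S x := by
  rw [prS_eq_sum]
  refine Finset.sum_pos' (fun v _ => ?_) ⟨x, Finset.mem_univ _, ?_⟩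
  · split_ifs
    · exact (hp v).le
    · exact le_rfl
  · simp [hp x]

lemma prS_mul_left (c : ℝ) (p : (∀ i, α i) → ℝ) (S : Set I) (x : ∀ i, α i) :
    prS (fun v => c * p v) S x = c * prS p S x := by
  rw [prS_eq_sum, prS_eq_sum, Finset.mul_sum]
  simp

lemma prS_add (p q : (∀ i, α i) → ℝ) (S : Set I) (x : ∀ i, α i) :
    prS (fun v => p v + q v) S x = prS p S x + prS q S x := by
  rw [prS_eq_sum, prS_eq_sum, prS_eq_sum, ← Finset.sum_add_distrib]
  refine Finset.sum_congr rfl fun v _ => ?_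
  split_ifs <;> simp

/-- if the summand vanishes off the coordinate `k` value, we may fix that coordinate. -/
lemma prS_insert_of_zero (p : (∀ i, α i) → ℝ) (S : Set I) (k : I) (x : ∀ i, α i)
    (h : ∀ v, v k ≠ x k → p v = 0) : prS p (insert k S) x = prS p S x := by
  rw [prS_eq_sum, prS_eq_sum]
  refine Finset.sum_congr rfl fun v _ => ?_
  by_cases hv : v k = x k
  · simp [hv]
  · simp [h v hv]

lemma prS_eq_of_superset {p q : (∀ i, α i) → ℝ} {U W : Set I} (h : U ⊆ W)
    (hpq : ∀ v, prS p W v = prS q W v) (x : ∀ i, α i) : prS p U x = prS q U x := by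
  rw [prS_tower' p h, prS_tower' q h]
  simp only [hpq]

end PrS

section Mech

/-- a family of (not necessarily positive) mechanisms. -/
structure Mech (E : I → I → Prop) (θ : I → (∀ i, α i) → ℝ) : Prop where
  dep : ∀ i (v w : ∀ i, α i), v i = w i → (∀ j, E j i → v j = w j) → θ i v = θ i w
  sum : ∀ i (v : ∀ i, α i), ∑ a : α i, θ i (Function.update v i a) = 1

/-- The joint function of a mechanism family. -/
noncomputable def jp (θ : I → (∀ i, α i) → ℝ) (v : ∀ i, α i) : ℝ := ∏ i, θ i v

/-- product of the mechanisms over a set. -/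
noncomputable def jpOn (θ : I → (∀ i, α i) → ℝ) (M : Set I) (v : ∀ i, α i) : ℝ :=
  ∏ i, if i ∈ M then θ i v else 1

lemma wf_of_dag {E : I → I → Prop} (hdag : Irreflexive (Relation.TransGen E)) :
    WellFounded E := by
  have : Std.Irrefl (Relation.TransGen E) := ⟨hdag⟩
  have h := Finite.wellFounded_of_trans_of_irrefl (Relation.TransGen E)
  exact Subrelation.wf (fun h => Relation.TransGen.single h) h

lemma prS_ancestral {E : I → I → Prop} (hdag : Irreflexive (Relation.TransGen E))
    {θ : I → (∀ i, α i) → ℝ} (hθ : Mech E θ) :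
    ∀ (n : ℕ) (M : Set I), (Mᶜ).ncard = n → (∀ i ∈ M, ∀ j, E j i → j ∈ M) →
      ∀ x, prS (jp θ) M x = jpOn θ M x := by
  intro n
  induction n with
  | zero =>
    intro M hM _ x
    have : M = Set.univ := by
      rw [Set.ncard_eq_zero (Set.toFinite _)] at hM
      simpa using hM
    subst this
    rw [prS_univ]; simp [jp, jpOn]
  | succ n ih =>
    intro M hM hcl x
    have hne : (Mᶜ).Nonempty := by
      rw [← Set.ncard_pos (Set.toFinite _)]; omega
    obtain ⟨k, hk, hmin⟩ := (wf_of_dag hdag).has_min _ hne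
    have hkM : k ∉ M := hk
    have hpar : ∀ j, E j k → j ∈ M := by
      intro j hj
      by_contra hjM
      exact hmin j hjM hj
    have hcard : ((insert k M)ᶜ).ncard = n := by
      have : (insert k M)ᶜ = Mᶜ \ {k} := by
        ext i; simp [not_or, and_comm]
      rw [this, Set.ncard_sdiff_singleton_of_mem hk]; omega
    have hcl' : ∀ i ∈ insert k M, ∀ j, E j i → j ∈ insert k M := by
      rintro i (rfl | hi) j hj
      · exact Or.inr (hpar j hj)
      · exact Or.inr (hcl i hi j hj)
    rw [prS_step _ hkM]
    have key : ∀ a : α k, prS (jp θ) (insert k M) (Function.update x k a)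
        = θ k (Function.update x k a) * jpOn θ M x := by
      intro a
      rw [ih _ hcard hcl']
      unfold jpOn
      rw [← Finset.mul_prod_erase _ _ (Finset.mem_univ k),
        ← Finset.mul_prod_erase (f := fun i => if i ∈ M then θ i x else 1) _ (Finset.mem_univ k)]
      simp only [Set.mem_insert_iff, true_or, if_true, hkM, if_false, one_mul]
      congr 1
      refine Finset.prod_congr rfl fun i hi => ?_
      have hik : i ≠ k := Finset.ne_of_mem_erase hi
      simp only [hik, false_or]
      split_ifs with hiM
      · apply hθ.dep
        · simp [hik]
        · intro j hj
          have : j ≠ k := by rintro rfl; exact hkM (hcl i hiM j hj)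
          simp [this]
      · rfl
    simp_rw [key]
    rw [← Finset.sum_mul, hθ.sum, one_mul]

lemma prS_anc {E : I → I → Prop} (hdag : Irreflexive (Relation.TransGen E))
    {θ : I → (∀ i, α i) → ℝ} (hθ : Mech E θ) {M : Set I}
    (hM : ∀ i ∈ M, ∀ j, E j i → j ∈ M) (x : ∀ i, α i) : prS (jp θ) M x = jpOn θ M x :=
  prS_ancestral hdag hθ _ M rfl hM x

lemma jp_sum {E : I → I → Prop} (hdag : Irreflexive (Relation.TransGen E))
    {θ : I → (∀ i, α i) → ℝ} (hθ : Mech E θ) : ∑ v, jp θ v = 1 := by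
  have x : ∀ i, α i := fun i => Classical.arbitrary _
  rw [← prS_empty (jp θ) x, prS_anc hdag hθ (by simp)]
  simp [jpOn]

lemma jp_pos {θ : I → (∀ i, α i) → ℝ} (hpos : ∀ i v, 0 < θ i v) (v : ∀ i, α i) :
    0 < jp θ v := Finset.prod_pos fun i _ => hpos i v

lemma jp_pmf {E : I → I → Prop} (hdag : Irreflexive (Relation.TransGen E))
    {θ : I → (∀ i, α i) → ℝ} (hθ : Mech E θ) (hpos : ∀ i v, 0 < θ i v) : IsPMF (jp θ) :=
  ⟨fun v => (jp_pos hpos v).le, by rw [finsum_eq_sum_of_fintype]; exact jp_sum hdag hθ⟩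

/-- the chain rule for nondescendant sets containing the parents. -/
lemma prS_local {E : I → I → Prop} (hdag : Irreflexive (Relation.TransGen E))
    {θ : I → (∀ i, α i) → ℝ} (hθ : Mech E θ) (i : I) :
    ∀ (n : ℕ) (U : Set I), ({j | ¬ Anc E i j} \ U).ncard = n → (∀ j, E j i → j ∈ U) →
      (U ⊆ {j | ¬ Anc E i j}) →
      ∀ x, prS (jp θ) (insert i U) x = θ i x * prS (jp θ) U x := by
  intro n
  induction n with
  | zero =>
    intro U hU hpa hsub x
    have hUe : U = {j | ¬ Anc E i j} := by
      rw [Set.ncard_eq_zero (Set.toFinite _), Set.sdiff_eq_empty] at hU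
      exact Set.Subset.antisymm hsub hU
    have hiU : i ∉ U := fun h => hsub h Relation.ReflTransGen.refl
    have hcl : ∀ k ∈ U, ∀ j, E j k → j ∈ U := by
      intro k hk j hj
      rw [hUe] at hk ⊢
      intro h
      exact hk (Relation.ReflTransGen.tail h hj)
    have hcl' : ∀ k ∈ insert i U, ∀ j, E j k → j ∈ insert i U := by
      rintro k (rfl | hk) j hj
      · exact Or.inr (hpa j hj)
      · exact Or.inr (hcl k hk j hj)
    rw [prS_anc hdag hθ hcl, prS_anc hdag hθ hcl']
    unfold jpOn
    rw [← Finset.mul_prod_erase _ _ (Finset.mem_univ i),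
        ← Finset.mul_prod_erase (f := fun k => if k ∈ U then θ k x else 1) _ (Finset.mem_univ i)]
    simp only [Set.mem_insert_iff, true_or, if_true, hiU, if_false, one_mul]
    congr 1
    refine Finset.prod_congr rfl fun k hk => ?_
    simp [Finset.ne_of_mem_erase hk]
  | succ n ih =>
    intro U hU hpa hsub x
    have hne : ({j | ¬ Anc E i j} \ U).Nonempty := by
      rw [← Set.ncard_pos (Set.toFinite _)]; omega
    obtain ⟨k, hkD, hkU⟩ := hne
    have hki : k ≠ i := by rintro rfl; exact hkD Relation.ReflTransGen.refl
    have hcard : ({j | ¬ Anc E i j} \ insert k U).ncard = n := by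
      have : {j | ¬ Anc E i j} \ insert k U = ({j | ¬ Anc E i j} \ U) \ {k} := by
        ext j; simp only [Set.mem_sdiff, Set.mem_insert_iff, Set.mem_singleton_iff]; tauto
      have hmem : k ∈ {j | ¬ Anc E i j} \ U := ⟨hkD, hkU⟩
      rw [this, Set.ncard_sdiff_singleton_of_mem hmem]; omega
    have ih' := ih (insert k U) hcard (fun j hj => Or.inr (hpa j hj))
      (Set.insert_subset hkD hsub)
    rw [prS_step (jp θ) hkU, prS_step (jp θ) (k := k) (U := insert i U) (by simp [hki, hkU]),
      Finset.mul_sum]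
    refine Finset.sum_congr rfl fun a _ => ?_
    rw [Set.insert_comm, ih']
    congr 1
    apply hθ.dep
    · simp [hki.symm]
    · intro j hj
      have : j ≠ k := by rintro rfl; exact hkU (hpa _ hj)
      simp [this]

lemma parents_nondesc {E : I → I → Prop} (hdag : Irreflexive (Relation.TransGen E)) {i j : I}
    (h : E j i) : ¬ Anc E i j := fun h' =>
  hdag i (Relation.TransGen.tail' h' h)

lemma jp_markov {E : I → I → Prop} (hdag : Irreflexive (Relation.TransGen E))
    {θ : I → (∀ i, α i) → ℝ} (hθ : Mech E θ) (hpos : ∀ i v, 0 < θ i v) (i : I) (v : ∀ i, α i) :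
    condPr (jp θ) {i} {j | E j i} v = θ i v := by
  unfold condPr
  rw [Set.singleton_union, prS_local hdag hθ i _ {j | E j i} rfl (fun j hj => hj)
    (fun j hj => parents_nondesc hdag hj)]
  rw [mul_div_cancel_right₀]
  exact (prS_pos (jp_pos hpos) _ _).ne'

lemma jp_markovCompat {E : I → I → Prop} (hdag : Irreflexive (Relation.TransGen E))
    {θ : I → (∀ i, α i) → ℝ} (hθ : Mech E θ) (hpos : ∀ i v, 0 < θ i v) :
    MarkovCompat (jp θ) E := by
  intro v
  rw [finprod_eq_prod_of_fintype]
  simp only [jp_markov hdag hθ hpos]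
  rfl

lemma mech_of_markov {E : I → I → Prop} (hdag : Irreflexive (Relation.TransGen E))
    {q : (∀ i, α i) → ℝ} (hpos : ∀ v, 0 < q v) :
    Mech E (fun i v => condPr q {i} {j | E j i} v) where
  dep := by
    intro i v w hi hpa
    unfold condPr
    congr 1
    · apply prS_congr
      rintro k (hk | hk)
      · rw [Set.mem_singleton_iff.1 hk]; exact hi
      · exact hpa k hk
    · apply prS_congr
      intro k hk; exact hpa k hk
  sum := by
    intro i v
    have hi : i ∉ {j | E j i} := fun h => hdag i (Relation.TransGen.single h)
    have : ∀ a, prS q {j | E j i} (Function.update v i a) = prS q {j | E j i} v := by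
      intro a
      apply prS_congr
      intro k hk
      have : k ≠ i := by rintro rfl; exact hi hk
      simp [this]
    simp only [condPr, this, Set.singleton_union]
    rw [← Finset.sum_div, ← prS_step q hi]
    exact div_self (prS_pos hpos _ _).ne'

lemma condPr_pos {q : (∀ i, α i) → ℝ} (hpos : ∀ v, 0 < q v) (A S : Set I) (v : ∀ i, α i) :
    0 < condPr q A S v := div_pos (prS_pos hpos _ _) (prS_pos hpos _ _)

lemma jp_of_markov {E : I → I → Prop} {q : (∀ i, α i) → ℝ} (hq : MarkovCompat q E) :
    jp (fun i v => condPr q {i} {j | E j i} v) = q := by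
  funext v
  rw [hq v, finprod_eq_prod_of_fintype]
  rfl

end Mech

section Graph

/-- ancestors of a set -/
def AncS (E : V → V → Prop) (W : Set V) : Set V := {v | ∃ w ∈ W, Anc E v w}

/-- adjacency in the moral graph of the induced subgraph on `M` -/
def MAdj (E : V → V → Prop) (M : Set V) (i j : V) : Prop :=
  i ∈ M ∧ j ∈ M ∧ (E i j ∨ E j i ∨ ∃ k ∈ M, E i k ∧ E j k)

/-- one step in the moral graph avoiding `U` -/
def MStep (E : V → V → Prop) (M U : Set V) (i j : V) : Prop := MAdj E M i j ∧ i ∉ U ∧ j ∉ U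

/-- connection in the moral graph avoiding `U` -/
def MConn (E : V → V → Prop) (M U : Set V) (a b : V) : Prop :=
  Relation.ReflTransGen (MStep E M U) a b

lemma MStep.symm {E : V → V → Prop} {M U : Set V} {i j : V} (h : MStep E M U i j) :
    MStep E M U j i := by
  obtain ⟨⟨hi, hj, h⟩, hiU, hjU⟩ := h
  refine ⟨⟨hj, hi, ?_⟩, hjU, hiU⟩
  rcases h with h | h | ⟨k, hk, h1, h2⟩
  · exact Or.inr (Or.inl h)
  · exact Or.inl h
  · exact Or.inr (Or.inr ⟨k, hk, h2, h1⟩)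

lemma MConn.symm {E : V → V → Prop} {M U : Set V} {i j : V} (h : MConn E M U i j) :
    MConn E M U j i := by
  induction h with
  | refl => exact Relation.ReflTransGen.refl
  | tail _ hs ih => exact Relation.ReflTransGen.head (MStep.symm hs) ih

lemma MConn.mono {E : V → V → Prop} {M M' U U' : Set V} (hM : M ⊆ M') (hU : U' ⊆ U) {i j : V}
    (h : MConn E M U i j) : MConn E M' U' i j := by
  induction h with
  | refl => exact Relation.ReflTransGen.refl
  | tail _ hs ih =>
  refine Relation.ReflTransGen.tail ih ?_
  obtain ⟨⟨ha, hb, h⟩, haU, hbU⟩ := hs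
  refine ⟨⟨hM ha, hM hb, ?_⟩, fun h => haU (hU h), fun h => hbU (hU h)⟩
  rcases h with h | h | ⟨k, hk, h1, h2⟩
  · exact Or.inl h
  · exact Or.inr (Or.inl h)
  · exact Or.inr (Or.inr ⟨k, hM hk, h1, h2⟩)

lemma dag_asymm {E : V → V → Prop} (hdag : Irreflexive (Relation.TransGen E)) {u v : V}
    (h : E u v) : ¬ E v u := fun h' =>
  hdag u (Relation.TransGen.tail (Relation.TransGen.single h) h')

/-- open walks, remembering whether the last edge points into the last vertex. -/
inductive OW (E : V → V → Prop) (S : Set V) (a : V) : V → Bool → Prop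
  | nil : OW E S a a false
  | fwd {u v : V} {β : Bool} : OW E S a u β → u ∉ S → E u v → OW E S a v true
  | bout {u v : V} : OW E S a u false → u ∉ S → E v u → OW E S a v false
  | bin {u v : V} : OW E S a u true → u ∈ AncS E S → E v u → OW E S a v false

/-- indexed open walks -/
structure Wk (E : V → V → Prop) (S : Set V) (a b : V) (n : ℕ) (w : ℕ → V) : Prop where
  first : w 0 = a
  last : w n = b
  adj : ∀ i, i < n → E (w i) (w (i + 1)) ∨ E (w (i + 1)) (w i)
  non : ∀ i, 0 < i → i < n → ¬ (E (w (i - 1)) (w i) ∧ E (w (i + 1)) (w i)) → w i ∉ S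
  col : ∀ i, 0 < i → i < n → (E (w (i - 1)) (w i) ∧ E (w (i + 1)) (w i)) → w i ∈ AncS E S

lemma Wk.extend {E : V → V → Prop} {S : Set V} {a u v : V} {n : ℕ} {w : ℕ → V}
    (h : Wk E S a u n w) (hadj : E u v ∨ E v u)
    (hnon : 0 < n → ¬ (E (w (n - 1)) u ∧ E v u) → u ∉ S)
    (hcol : 0 < n → (E (w (n - 1)) u ∧ E v u) → u ∈ AncS E S) :
    Wk E S a v (n + 1) (fun i => if i ≤ n then w i else v) := by
  have hl := h.last
  subst hl
  refine ⟨?_, ?_, ?_, ?_, ?_⟩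
  · simp [h.first]
  · simp
  · intro i hi
    rcases Nat.lt_or_ge i n with hin | hin
    · have := h.adj i hin
      simpa [hin.le, Nat.succ_le_of_lt hin] using this
    · have : i = n := by omega
      subst this
      simpa using hadj
  · intro i h0 hi
    rcases Nat.lt_or_ge i n with hin | hin
    · have := h.non i h0 hin
      simpa [hin.le, Nat.succ_le_of_lt hin, show i ≤ n + 1 by omega] using this
    · have : i = n := by omega
      subst this
      simpa using hnon h0
  · intro i h0 hi
    rcases Nat.lt_or_ge i n with hin | hin
    · have := h.col i h0 hin
      simpa [hin.le, Nat.succ_le_of_lt hin, show i ≤ n + 1 by omega] using this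
    · have : i = n := by omega
      subst this
      simpa using hcol h0

lemma OW.toWk {E : V → V → Prop} (hdag : Irreflexive (Relation.TransGen E)) {S : Set V} {a v : V}
    {β : Bool} (h : OW E S a v β) :
    ∃ n w, Wk E S a v n w ∧ (β = true → 0 < n ∧ E (w (n - 1)) (w n)) ∧
      (β = false → n = 0 ∨ E (w n) (w (n - 1))) := by
  induction h with
  | nil =>
    refine ⟨0, fun _ => a, ⟨rfl, rfl, ?_, ?_, ?_⟩, ?_, ?_⟩ <;> simp
  | @fwd u v β _ hu huv ih =>
    obtain ⟨n, w, hw, -, -⟩ := ih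
    refine ⟨n + 1, _, hw.extend (Or.inl huv) (fun _ _ => hu)
      (fun _ h => absurd h.2 (dag_asymm hdag huv)), ?_, ?_⟩
    · intro _; simp [hw.last, huv]
    · simp
  | @bout u v _ hu hvu ih =>
    obtain ⟨n, w, hw, -, h2⟩ := ih
    refine ⟨n + 1, _, hw.extend (Or.inr hvu) (fun _ _ => hu) (fun h0 h => ?_), ?_, ?_⟩
    · rcases h2 rfl with h3 | h3
      · omega
      · rw [hw.last] at h3
        exact absurd h.1 (dag_asymm hdag h3)
    · simp
    · intro _; right; simp [hw.last, hvu]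
  | @bin u v _ hu hvu ih =>
    obtain ⟨n, w, hw, h1, -⟩ := ih
    refine ⟨n + 1, _, hw.extend (Or.inr hvu) (fun h0 h => ?_) (fun h0 h => hu), ?_, ?_⟩
    · exfalso; apply h
      have := (h1 rfl).2
      rw [hw.last] at this
      exact ⟨this, hvu⟩
    · simp
    · intro _; right; simp [hw.last, hvu]

/-- if a walk leaves `w i` by an outgoing edge and comes to `w j` by an edge out of `w j`,
there is a collider in between, a descendant of `w i`. -/
lemma Wk.find_col {E : V → V → Prop} (hdag : Irreflexive (Relation.TransGen E)) {S : Set V}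
    {a b : V} {n : ℕ} {w : ℕ → V}
    (h : Wk E S a b n w) : ∀ (d i : ℕ), i + d + 1 < n + 1 → E (w i) (w (i + 1)) →
      E (w (i + d + 1)) (w (i + d)) → w i ∈ AncS E S := by
  intro d
  induction d with
  | zero =>
    intro i hi h1 h2
    exact absurd h2 (dag_asymm hdag h1)
  | succ d ih =>
    intro i hi h1 h2
    rcases h.adj (i + 1) (by omega) with h3 | h3
    · have := ih (i + 1) (by omega) h3 (by
        convert h2 using 2 <;> omega)
      obtain ⟨s, hs, hd⟩ := this
      exact ⟨s, hs, Relation.ReflTransGen.head h1 hd⟩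
    · obtain ⟨s, hs, hd⟩ := h.col (i + 1) (by omega) (by omega) ⟨by simpa using h1, h3⟩
      exact ⟨s, hs, Relation.ReflTransGen.head h1 hd⟩

lemma Wk.cut {E : V → V → Prop} (hdag : Irreflexive (Relation.TransGen E)) {S : Set V}
    {a b : V} {n : ℕ} {w : ℕ → V}
    (h : Wk E S a b n w) {i j : ℕ} (hij : i < j) (hj : j ≤ n) (he : w i = w j) :
    Wk E S a b (n - (j - i)) (fun k => if k ≤ i then w k else w (k + (j - i))) := by
  obtain ⟨d, rfl⟩ : ∃ d, j = i + d := ⟨j - i, by omega⟩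
  have hd : i + d - i = d := by omega
  rw [hd]
  set w' : ℕ → V := fun k => if k ≤ i then w k else w (k + d) with hw'
  have hlo : ∀ k, k ≤ i → w' k = w k := fun k hk => by simp [hw', hk]
  have hhi : ∀ k, i ≤ k → w' k = w (k + d) := by
    intro k hk
    rcases Nat.eq_or_lt_of_le hk with rfl | hk
    · simp [hw', he]
    · simp [hw', Nat.not_le.2 hk]
  refine ⟨?_, ?_, ?_, ?_, ?_⟩
  · rw [hlo 0 (by omega), h.first]
  · rw [hhi _ (by omega), show n - d + d = n by omega, h.last]
  · intro k hk
    rcases Nat.lt_or_ge k i with hki | hki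
    · rw [hlo _ hki.le, hlo _ hki]; exact h.adj k (by omega)
    · rw [hhi _ hki, hhi _ (by omega), show k + 1 + d = k + d + 1 by omega]
      exact h.adj _ (by omega)
  · intro k h0 hk hnc
    rcases lt_trichotomy k i with hki | hki | hki
    · rw [hlo _ hki.le, hlo _ hki, hlo _ (by omega)] at hnc
      rw [hlo _ hki.le]
      exact h.non k h0 (by omega) hnc
    · subst hki
      rw [hlo _ (by omega), hlo _ le_rfl, hhi _ (by omega)] at hnc
      rw [hlo _ le_rfl]
      by_cases h1 : E (w (k - 1)) (w k)
      · have h2 : ¬ E (w (k + 1 + d)) (w k) := fun h2 => hnc ⟨h1, h2⟩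
        rw [he]
        refine h.non (k + d) (by omega) (by omega) ?_
        rintro ⟨-, h3⟩
        apply h2
        rw [he, show k + 1 + d = k + d + 1 by omega]
        exact h3
      · exact h.non k h0 (by omega) (fun h3 => h1 h3.1)
    · rw [hhi _ hki.le, hhi _ (by omega), hhi _ (by omega),
        show k - 1 + d = k + d - 1 by omega, show k + 1 + d = k + d + 1 by omega] at hnc
      rw [hhi _ hki.le]
      exact h.non _ (by omega) (by omega) hnc
  · intro k h0 hk hc
    rcases lt_trichotomy k i with hki | hki | hki
    · rw [hlo _ hki.le, hlo _ hki, hlo _ (by omega)] at hc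
      rw [hlo _ hki.le]
      exact h.col k h0 (by omega) hc
    · subst hki
      rw [hlo _ (by omega), hlo _ le_rfl, hhi _ (by omega)] at hc
      rw [hlo _ le_rfl]
      obtain ⟨h1, h2⟩ := hc
      rcases h.adj k (by omega) with h3 | h3
      · by_cases h4 : E (w (k + d - 1)) (w (k + d))
        · rw [he]
          refine h.col (k + d) (by omega) (by omega) ⟨h4, ?_⟩
          rw [← he, show k + d + 1 = k + 1 + d by omega]
          exact h2
        · have h5 : E (w (k + d)) (w (k + d - 1)) := by
            have := h.adj (k + d - 1) (by omega)
            rw [show k + d - 1 + 1 = k + d by omega] at this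
            tauto
          refine h.find_col hdag (d - 1) k (by omega) h3 ?_
          rw [show k + (d - 1) + 1 = k + d by omega, show k + (d - 1) = k + d - 1 by omega]
          exact h5
      · exact h.col k h0 (by omega) ⟨h1, h3⟩
    · rw [hhi _ hki.le, hhi _ (by omega), hhi _ (by omega),
        show k - 1 + d = k + d - 1 by omega, show k + 1 + d = k + d + 1 by omega] at hc
      rw [hhi _ hki.le]
      exact h.col _ (by omega) (by omega) hc

lemma Wk.toPath {E : V → V → Prop} (hdag : Irreflexive (Relation.TransGen E)) {S : Set V}
    {a b : V} (hab : a ≠ b) (h : ∃ n w, Wk E S a b n w) :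
    ∃ p : GPath E a b, p.OpenGiven S := by
  obtain ⟨w, hw⟩ := Nat.find_spec h
  have hmin : ∀ m, m < Nat.find h → ¬ ∃ w, Wk E S a b m w := fun m hm => Nat.find_min h hm
  set n := Nat.find h
  have hpos : 0 < n := by
    rcases Nat.eq_zero_or_pos n with h0 | h0
    · exfalso; apply hab
      have := hw.last
      rw [h0, hw.first] at this
      exact this
    · exact h0
  have hlt : ∀ i j, i < j → j ≤ n → w i ≠ w j := by
    intro i j hij hj he
    exact hmin (n - (j - i)) (by omega) ⟨_, hw.cut hdag hij hj he⟩
  refine ⟨⟨n, hpos, w, hw.first, hw.last, ?_, hw.adj⟩, ?_, ?_⟩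
  · intro i j hi hj he
    rcases lt_trichotomy i j with hij | hij | hij
    · exact absurd he (hlt i j hij hj)
    · exact hij
    · exact absurd he.symm (hlt j i hij hi)
  · intro i h0 hi hnc
    exact hw.non i h0 hi (fun hc => hnc ⟨h0, hi, hc⟩)
  · rintro i ⟨h0, hi, hc⟩
    exact hw.col i h0 hi hc

lemma OW.down {E : V → V → Prop} {S : Set V} {a u b : V} (hub : Anc E u b) :
    (u ∉ AncS E S) → (∃ β, OW E S a u β) → ∃ β, OW E S a b β := by
  induction hub using Relation.ReflTransGen.head_induction_on with
  | refl => exact fun _ h => h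
  | @head u c huc hcb ih =>
    rintro hu ⟨β, h⟩
    refine ih ?_ ⟨true, OW.fwd h (fun hS => hu ⟨u, hS, Relation.ReflTransGen.refl⟩) huc⟩
    rintro ⟨s, hs, hd⟩
    exact hu ⟨s, hs, Relation.ReflTransGen.head huc hd⟩

lemma OW.up {E : V → V → Prop} {S : Set V} {a c : V} (hca : Anc E c a) :
    (c ∉ AncS E S) → OW E S a c false := by
  induction hca using Relation.ReflTransGen.head_induction_on with
  | refl => exact fun _ => OW.nil
  | @head c d hcd hda ih =>
    intro hc
    have hd : d ∉ AncS E S := by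
      rintro ⟨s, hs, hds⟩
      exact hc ⟨s, hs, Relation.ReflTransGen.head hcd hds⟩
    exact OW.bout (ih hd) (fun hS => hd ⟨d, hS, Relation.ReflTransGen.refl⟩) hcd

lemma OW.back {E : V → V → Prop} {S : Set V} {a b u v : V} {β : Bool}
    (h : OW E S a u β) (hu : u ∈ AncS E ({a} ∪ {b} ∪ S)) (hf : β = false → u ∉ S) (hvu : E v u) :
    (∃ β, OW E S a b β) ∨ OW E S a v false := by
  cases β with
  | false => exact Or.inr (OW.bout h (hf rfl) hvu)
  | true =>
    by_cases hS : u ∈ AncS E S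
    · exact Or.inr (OW.bin h hS hvu)
    · obtain ⟨s, (rfl | rfl) | hs, hd⟩ := hu
      · exact Or.inr (OW.bout (OW.up hd hS) (fun h => hS ⟨u, h, Relation.ReflTransGen.refl⟩) hvu)
      · exact Or.inl (OW.down hd hS ⟨_, h⟩)
      · exact absurd ⟨s, hs, hd⟩ hS

lemma OW.of_mconn {E : V → V → Prop} {S : Set V} {a b m : V}
    (h : MConn E (AncS E ({a} ∪ {b} ∪ S)) S a m) :
    (∃ β, OW E S a b β) ∨ ∃ β, OW E S a m β := by
  induction h with
  | refl => exact Or.inr ⟨_, OW.nil⟩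
  | @tail m c _ hs ih =>
    rcases ih with ih | ⟨β, ih⟩
    · exact Or.inl ih
    obtain ⟨⟨hm, hc, h⟩, hmS, hcS⟩ := hs
    rcases h with h | h | ⟨k, hk, h1, h2⟩
    · exact Or.inr ⟨_, OW.fwd ih hmS h⟩
    · rcases OW.back ih hm (fun _ => hmS) h with h' | h'
      · exact Or.inl h'
      · exact Or.inr ⟨_, h'⟩
    · rcases OW.back (OW.fwd ih hmS h1) hk (by simp) h2 with h' | h'
      · exact Or.inl h'
      · exact Or.inr ⟨_, h'⟩

theorem open_of_mconn {E : V → V → Prop} (hdag : Irreflexive (Relation.TransGen E)) {S : Set V}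
    {a b : V} (hab : a ≠ b) (h : MConn E (AncS E ({a} ∪ {b} ∪ S)) S a b) :
    ∃ p : GPath E a b, p.OpenGiven S := by
  have : ∃ β, OW E S a b β := by
    rcases OW.of_mconn h with h | h <;> exact h
  obtain ⟨β, h⟩ := this
  obtain ⟨n, w, hw, -, -⟩ := h.toWk hdag
  exact Wk.toPath hdag hab ⟨n, w, hw⟩

lemma AncS_of_edge {E : V → V → Prop} {W : Set V} {u v : V} (h : E u v) (hv : v ∈ AncS E W) :
    u ∈ AncS E W := by
  obtain ⟨s, hs, hd⟩ := hv
  exact ⟨s, hs, Relation.ReflTransGen.head h hd⟩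

lemma AncS_self {E : V → V → Prop} {W : Set V} {u : V} (h : u ∈ W) : u ∈ AncS E W :=
  ⟨u, h, Relation.ReflTransGen.refl⟩

lemma AncS_mono {E : V → V → Prop} {W W' : Set V} (h : W ⊆ W') : AncS E W ⊆ AncS E W' := by
  rintro u ⟨s, hs, hd⟩
  exact ⟨s, h hs, hd⟩

theorem mconn_of_open {E : V → V → Prop} (hdag : Irreflexive (Relation.TransGen E)) {S : Set V}
    {a b : V} (ha : a ∉ S) (hb : b ∉ S) (p : GPath E a b) (hp : p.OpenGiven S) :
    MConn E (AncS E ({a} ∪ {b} ∪ S)) S a b := by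
  set M := AncS E ({a} ∪ {b} ∪ S) with hM
  obtain ⟨hnon, hcol⟩ := hp
  have hcolM : ∀ i, p.IsColliderAt i → p.vtx i ∈ M := by
    intro i hi
    obtain ⟨d, hd, h⟩ := hcol i hi
    exact ⟨d, Or.inr hd, h⟩
  have hR : ∀ d i, i + d + 1 = p.len → E (p.vtx i) (p.vtx (i + 1)) → p.vtx i ∈ M := by
    intro d
    induction d with
    | zero =>
      intro i hi h
      refine AncS_of_edge h ?_
      rw [show i + 1 = p.len by omega, p.last]
      exact AncS_self (Or.inl (Or.inr rfl))
    | succ d ih =>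
      intro i hi h
      refine AncS_of_edge h ?_
      rcases p.adj (i + 1) (by omega) with h1 | h1
      · exact ih (i + 1) (by omega) h1
      · exact hcolM (i + 1) ⟨by omega, by omega, by simpa using h, h1⟩
  have hL : ∀ i, i < p.len → E (p.vtx (i + 1)) (p.vtx i) → p.vtx (i + 1) ∈ M := by
    intro i
    induction i with
    | zero =>
      intro hi h
      refine AncS_of_edge h ?_
      rw [p.first]
      exact AncS_self (Or.inl (Or.inl rfl))
    | succ i ih =>
      intro hi h
      refine AncS_of_edge h ?_
      rcases p.adj i (by omega) with h1 | h1
      · exact hcolM (i + 1) ⟨by omega, by omega, by simpa using h1, h⟩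
      · exact ih (by omega) h1
  have hall : ∀ i, i ≤ p.len → p.vtx i ∈ M := by
    intro i hi
    rcases Nat.eq_or_lt_of_le hi with rfl | hi'
    · rw [p.last]; exact AncS_self (Or.inl (Or.inr rfl))
    · rcases p.adj i hi' with h | h
      · exact hR (p.len - i - 1) i (by omega) h
      · rcases Nat.eq_zero_or_pos i with rfl | h0
        · rw [p.first]; exact AncS_self (Or.inl (Or.inl rfl))
        · rcases p.adj (i - 1) (by omega) with h1 | h1
          · rw [show i - 1 + 1 = i by omega] at h1
            exact hcolM i ⟨h0, hi', h1, h⟩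
          · have := hL (i - 1) (by omega) h1
            rwa [show i - 1 + 1 = i by omega] at this
  have key : ∀ i, i ≤ p.len → p.vtx i ∉ S → MConn E M S a (p.vtx i) := by
    intro i
    induction i using Nat.strong_induction_on with
    | _ i ih =>
    intro hi hiS
    rcases Nat.eq_zero_or_pos i with rfl | h0
    · rw [p.first]; exact Relation.ReflTransGen.refl
    by_cases h1 : p.vtx (i - 1) ∈ S
    · have h10 : 0 < i - 1 := by
        rcases Nat.eq_zero_or_pos (i - 1) with h | h
        · rw [h, p.first] at h1; exact absurd h1 ha
        · exact h
      have hc : p.IsColliderAt (i - 1) := by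
        by_contra hc
        exact hnon (i - 1) h10 (by omega) hc h1
      obtain ⟨-, -, hc1, hc2⟩ := hc
      rw [show i - 1 + 1 = i by omega] at hc2
      have h2 : p.vtx (i - 1 - 1) ∉ S := by
        rcases Nat.eq_zero_or_pos (i - 1 - 1) with h | h
        · rw [h, p.first]; exact ha
        · refine hnon _ h (by omega) ?_
          rintro ⟨-, -, -, h3⟩
          rw [show i - 1 - 1 + 1 = i - 1 by omega] at h3
          exact dag_asymm hdag hc1 h3
      refine Relation.ReflTransGen.tail (ih (i - 1 - 1) (by omega) (by omega) h2)
        ⟨⟨hall _ (by omega), hall _ hi, Or.inr (Or.inr ⟨_, hall (i - 1) (by omega), hc1, hc2⟩)⟩,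
          h2, hiS⟩
    · refine Relation.ReflTransGen.tail (ih (i - 1) (by omega) (by omega) h1)
        ⟨⟨hall _ (by omega), hall _ hi, ?_⟩, h1, hiS⟩
      have := p.adj (i - 1) (by omega)
      rw [show i - 1 + 1 = i by omega] at this
      tauto
  have := key p.len le_rfl (by rw [p.last]; exact hb)
  rwa [p.last] at this

theorem mconn_iff_not_dsep {E : V → V → Prop} (hdag : Irreflexive (Relation.TransGen E))
    {S : Set V} {a b : V} (ha : a ∉ S) (hb : b ∉ S) (hab : a ≠ b) :
    MConn E (AncS E ({a} ∪ {b} ∪ S)) S a b ↔ ¬ DSep E {a} {b} S := by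
  constructor
  · intro h hs
    obtain ⟨p, hp⟩ := open_of_mconn hdag hab h
    exact hs a rfl b rfl p hp
  · intro h
    unfold DSep at h
    push Not at h
    obtain ⟨a', rfl, b', rfl, p, hp⟩ := h
    exact mconn_of_open hdag ha hb p hp

end Graph

section Sound

lemma prS_eq_filter (p : (∀ i, α i) → ℝ) (S : Set I) (x : ∀ i, α i) :
    prS p S x = ∑ v ∈ Finset.univ.filter (fun v : (∀ i, α i) => ∀ i ∈ S, v i = x i), p v := by
  rw [prS_eq_sum, Finset.sum_filter]

lemma condIndep_iff {p : (∀ i, α i) → ℝ} (hpos : ∀ v, 0 < p v) (A B S : Set I) :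
    CondIndep p A B S ↔ ∀ x, prS p (A ∪ B ∪ S) x * prS p S x
      = prS p (A ∪ S) x * prS p (B ∪ S) x := by
  unfold CondIndep condPr
  refine forall_congr' fun x => ?_
  have h := (prS_pos hpos S x).ne'
  constructor
  · intro h1
    field_simp at h1
    linarith
  · intro h1
    field_simp
    linarith

lemma swap_ci (p : (∀ i, α i) → ℝ) {M A B S C : Set I} (hA : A ⊆ M) (hB : B ⊆ M) (hS : S ⊆ M)
    (hAC : A ⊆ C) (hBC : ∀ i ∈ B, i ∉ C) (hSC : ∀ i ∈ S, i ∉ C)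
    (hP : ∀ v w : (∀ i, α i), (∀ i ∈ S, v i = w i) →
      prS p M v * prS p M w = prS p M (fun i => if i ∈ C then w i else v i) *
        prS p M (fun i => if i ∈ C then v i else w i)) (x : ∀ i, α i) :
    prS p (A ∪ B ∪ S) x * prS p S x = prS p (B ∪ S) x * prS p (A ∪ S) x := by
  rw [prS_tower' p (U := A ∪ B ∪ S) (W := M) (Set.union_subset (Set.union_subset hA hB) hS),
    prS_tower' p hS, prS_tower' p (U := A ∪ S) (W := M) (Set.union_subset hA hS),
    prS_tower' p (U := B ∪ S) (W := M) (Set.union_subset hB hS)]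
  simp only [prS_eq_sum (fun v => prS p M v)]
  rw [Finset.sum_mul_sum, Finset.sum_mul_sum, ← Finset.sum_product', ← Finset.sum_product']
  let e : (∀ i, α i) × (∀ i, α i) → (∀ i, α i) × (∀ i, α i) := fun vw =>
    (fun i => if i ∈ C then vw.2 i else vw.1 i, fun i => if i ∈ C then vw.1 i else vw.2 i)
  have he : ∀ vw, e (e vw) = vw := by
    intro vw
    ext i <;> by_cases hi : i ∈ C <;> simp [e, hi]
  refine Finset.sum_nbij' e e (by simp) (by simp) (fun vw _ => he vw) (fun vw _ => he vw) ?_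
  rintro ⟨v, w⟩ -
  have hiff : ((∀ i ∈ (M \ (A ∪ B ∪ S))ᶜ, v i = x i) ∧ (∀ i ∈ (M \ S)ᶜ, w i = x i)) ↔
      ((∀ i ∈ (M \ (B ∪ S))ᶜ, (e (v, w)).1 i = x i) ∧
        (∀ i ∈ (M \ (A ∪ S))ᶜ, (e (v, w)).2 i = x i)) := by
    simp only [Set.mem_compl_iff, Set.mem_sdiff, Set.mem_union, e]
    constructor
    · rintro ⟨h1, h2⟩
      refine ⟨fun i hi => ?_, fun i hi => ?_⟩
      · have := hBC i; have := hSC i; have := h1 i; have := h2 i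
        split_ifs <;> tauto
      · have := @hAC i; have := hSC i; have := h1 i; have := h2 i
        split_ifs <;> tauto
    · rintro ⟨h1, h2⟩
      refine ⟨fun i hi => ?_, fun i hi => ?_⟩
      · have := h1 i; have := h2 i; have := hBC i; have := @hAC i
        by_cases hc : i ∈ C
        · simp only [hc, if_true] at *; tauto
        · simp only [hc, if_false] at *; tauto
      · have := h1 i; have := h2 i; have := hSC i; have := @hAC i
        by_cases hc : i ∈ C
        · simp only [hc, if_true] at *; tauto
        · simp only [hc, if_false] at *; tauto
  by_cases h : (∀ i ∈ (M \ (A ∪ B ∪ S))ᶜ, v i = x i) ∧ (∀ i ∈ (M \ S)ᶜ, w i = x i)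
  · have h' := hiff.1 h
    dsimp only
    rw [if_pos h.1, if_pos h.2, if_pos h'.1, if_pos h'.2]
    apply hP
    intro i hi
    rw [h.1 i (fun h => h.2 (Or.inr hi)), h.2 i (fun h => h.2 hi)]
  · have h' : ¬ (_ ∧ _) := fun h' => h (hiff.2 h')
    dsimp only
    rw [not_and_or] at h
    rw [not_and_or] at h'
    have e1 : ∀ (P Q : Prop) {_ : Decidable P} {_ : Decidable Q} (c d : ℝ), ¬ P ∨ ¬ Q →
        (if P then c else 0) * (if Q then d else 0) = 0 := by
      intro P Q _ _ c d h
      rcases h with h | h <;> simp [h]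
    exact (e1 _ _ _ _ h).trans (e1 _ _ _ _ h').symm

theorem sound {E : I → I → Prop} (hdag : Irreflexive (Relation.TransGen E))
    {θ : I → (∀ i, α i) → ℝ} (hθ : Mech E θ) {a b : I} {S : Set I} (ha : a ∉ S)
    (h : ¬ MConn E (AncS E ({a} ∪ {b} ∪ S)) S a b) (x : ∀ i, α i) :
    prS (jp θ) ({a} ∪ {b} ∪ S) x * prS (jp θ) S x
      = prS (jp θ) ({a} ∪ S) x * prS (jp θ) ({b} ∪ S) x := by
  set M := AncS E ({a} ∪ {b} ∪ S) with hM
  set C : Set I := {c | MConn E M S a c} with hC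
  have hcl : ∀ i ∈ M, ∀ j, E j i → j ∈ M := fun i hi j hj => AncS_of_edge hj hi
  have hCS : ∀ c ∈ C, c ∉ S := by
    intro c hc
    rcases Relation.ReflTransGen.cases_tail hc with h | ⟨d, _, hd⟩
    · rw [h]; exact ha
    · exact hd.2.2
  rw [mul_comm (prS (jp θ) ({a} ∪ S) x)]
  refine swap_ci (jp θ) (M := M) (C := C) ?_ ?_ ?_ ?_ ?_ ?_ ?_ x
  · rintro _ rfl; exact AncS_self (Or.inl (Or.inl rfl))
  · rintro _ rfl; exact AncS_self (Or.inl (Or.inr rfl))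
  · intro i hi; exact AncS_self (Or.inr hi)
  · rintro _ rfl; exact Relation.ReflTransGen.refl
  · rintro _ rfl; exact h
  · intro i hi hc; exact hCS i hc hi
  · intro v w hvw
    simp only [prS_anc hdag hθ hcl]
    unfold jpOn
    rw [← Finset.prod_mul_distrib, ← Finset.prod_mul_distrib]
    refine Finset.prod_congr rfl fun i _ => ?_
    split_ifs with hi
    swap
    · rfl
    have hclique : ∀ e f, (e = i ∨ E e i) → (f = i ∨ E f i) → e ∈ C → f ∉ S → f ∈ C := by
      intro e f he hf hec hfS
      by_cases hef : e = f
      · rwa [← hef]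
      have heM : e ∈ M := by
        rcases he with rfl | he
        · exact hi
        · exact hcl i hi e he
      have hfM : f ∈ M := by
        rcases hf with rfl | hf
        · exact hi
        · exact hcl i hi f hf
      refine Relation.ReflTransGen.tail hec ⟨⟨heM, hfM, ?_⟩, hCS e hec, hfS⟩
      rcases he with rfl | he <;> rcases hf with rfl | hf
      · exact absurd rfl hef
      · exact Or.inr (Or.inl hf)
      · exact Or.inl he
      · exact Or.inr (Or.inr ⟨i, hi, he, hf⟩)
    by_cases hex : ∃ e, (e = i ∨ E e i) ∧ e ∈ C
    · obtain ⟨e, he, hec⟩ := hex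
      have hall : ∀ f, (f = i ∨ E f i) → f ∈ C ∨ f ∈ S := by
        intro f hf
        by_cases hfS : f ∈ S
        · exact Or.inr hfS
        · exact Or.inl (hclique e f he hf hec hfS)
      have e1 : ∀ f, (f = i ∨ E f i) → (if f ∈ C then w f else v f) = w f := by
        intro f hf
        rcases hall f hf with h | h
        · simp [h]
        · split_ifs
          · rfl
          · exact hvw f h
      have e2 : ∀ f, (f = i ∨ E f i) → (if f ∈ C then v f else w f) = v f := by
        intro f hf
        rcases hall f hf with h | h
        · simp [h]
        · split_ifs
          · rfl
          · exact (hvw f h).symm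
      rw [hθ.dep i (fun i => if i ∈ C then w i else v i) w (e1 i (Or.inl rfl))
          (fun j hj => e1 j (Or.inr hj)),
        hθ.dep i (fun i => if i ∈ C then v i else w i) v (e2 i (Or.inl rfl))
          (fun j hj => e2 j (Or.inr hj)), mul_comm]
    · have hno : ∀ f, (f = i ∨ E f i) → f ∉ C := fun f hf hc => hex ⟨f, hf, hc⟩
      rw [hθ.dep i (fun i => if i ∈ C then w i else v i) v (by simp [hno i (Or.inl rfl)])
          (fun j hj => by simp [hno j (Or.inr hj)]),
        hθ.dep i (fun i => if i ∈ C then v i else w i) w (by simp [hno i (Or.inl rfl)])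
          (fun j hj => by simp [hno j (Or.inr hj)])]

end Sound

section Adj

/-- summand of the adjustment formula -/
noncomputable def adjG (q : (∀ i, α i) → ℝ) (X Y Z : Set I) (w : ∀ i, α i) : ℝ :=
  condPr q Y (X ∪ Z) w * prS q Z w

lemma sum_merge (F : (∀ i, α i) → ℝ) (X Z : Set I) (x y : ∀ i, α i) :
    (∑ᶠ z : (∀ j : Z, α j.1), F (mergeVals X Z x z y))
      = prS F Zᶜ (fun i => if i ∈ X then x i else y i) := by
  rw [finsum_eq_sum_of_fintype, prS_eq_filter]
  refine Finset.sum_nbij' (fun z => mergeVals X Z x z y) (fun v j => v j.1) ?_ ?_ ?_ ?_ ?_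
  · intro z _
    simp only [Finset.mem_filter, Finset.mem_univ, true_and]
    intro i hi
    simp [mergeVals, show i ∉ Z from hi]
  · intro v _; exact Finset.mem_univ _
  · intro z _
    funext j
    simp [mergeVals]
  · intro v hv
    simp only [Finset.mem_filter, Finset.mem_univ, true_and] at hv
    funext i
    by_cases hi : i ∈ Z
    · simp [mergeVals, hi]
    · have := hv i hi
      simp [mergeVals, hi, this]
  · intro z _; rfl

lemma isAdj_iff (E : I → I → Prop) (X Y Z : Set I) :
    IsAdjustmentSet (α := α) E X Y Z ↔
    ∀ q : (∀ i, α i) → ℝ, IsPMF q → (∀ v, 0 < q v) → MarkovCompat q E →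
    ∀ x y : ∀ i, α i, prS (doPMF q E X x) Y y =
      prS (adjG q X Y Z) Zᶜ (fun i => if i ∈ X then x i else y i) := by
  unfold IsAdjustmentSet
  refine forall_congr' fun q => forall₃_congr fun _ _ _ => forall₂_congr fun x y => ?_
  rw [← sum_merge]
  rfl

lemma prS_update (p : (∀ i, α i) → ℝ) (U : Set I) (k : I) (a : α k) (x : ∀ i, α i) :
    prS p (insert k U) (Function.update x k a)
      = prS (fun v => p (Function.update v k a)) (insert k U) x := by
  rw [prS_eq_filter, prS_eq_filter]
  refine Finset.sum_nbij' (fun v => Function.update v k (x k)) (fun v => Function.update v k a)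
    ?_ ?_ ?_ ?_ ?_
  · intro v hv
    simp only [Finset.mem_filter, Finset.mem_univ, true_and] at hv ⊢
    intro i hi
    by_cases hik : i = k
    · subst hik; simp
    · have := hv i hi
      simpa [hik] using this
  · intro v hv
    simp only [Finset.mem_filter, Finset.mem_univ, true_and] at hv ⊢
    intro i hi
    by_cases hik : i = k
    · subst hik; simp
    · have := hv i hi
      simpa [hik] using this
  · intro v hv
    simp only [Finset.mem_filter, Finset.mem_univ, true_and] at hv
    have := hv k (Or.inl rfl)
    simp only [Function.update_self] at this
    simp [← this]
  · intro v hv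
    simp only [Finset.mem_filter, Finset.mem_univ, true_and] at hv
    have := hv k (Or.inl rfl)
    simp [← this]
  · intro v hv
    simp only [Finset.mem_filter, Finset.mem_univ, true_and] at hv
    have := hv k (Or.inl rfl)
    simp only [Function.update_self] at this
    simp [← this]

lemma prS_finset_sum {ι : Type*} (s : Finset ι) (f : ι → (∀ i, α i) → ℝ) (U : Set I)
    (x : ∀ i, α i) : prS (fun v => ∑ a ∈ s, f a v) U x = ∑ a ∈ s, prS (f a) U x := by
  simp only [prS_eq_sum]
  rw [Finset.sum_comm]
  refine Finset.sum_congr rfl fun v _ => ?_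
  split_ifs <;> simp

lemma prS_step2 (p : (∀ i, α i) → ℝ) {U : Set I} {k : I} (hk : k ∉ U) (x : ∀ i, α i) :
    prS p U x = prS (fun v => ∑ a : α k, p (Function.update v k a)) (insert k U) x := by
  rw [prS_step p hk, prS_finset_sum]
  simp only [prS_update]

lemma adj_remove {q : (∀ i, α i) → ℝ} (hpos : ∀ v, 0 < q v) {X Y t : I} {T : Set I}
    (hX : X ∉ T) (hY : Y ∉ T) (ht : t ∈ T)
    (h : CondIndep q {X} {t} (T \ {t}) ∨ CondIndep q {Y} {t} ((T \ {t}) ∪ {X}))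
    (b : ∀ i, α i) :
    prS (adjG q {X} {Y} T) Tᶜ b = prS (adjG q {X} {Y} (T \ {t})) (T \ {t})ᶜ b := by
  have hset : (T \ {t})ᶜ = insert t Tᶜ := by
    ext i; simp only [Set.mem_compl_iff, Set.mem_sdiff, Set.mem_singleton_iff, Set.mem_insert_iff]
    tauto
  rw [hset, prS_step2 _ (k := t) (U := Tᶜ) (by simpa using ht)]
  congr 1
  funext v
  obtain ⟨T', hT'⟩ : ∃ T', T' = T \ {t} := ⟨_, rfl⟩
  have htT' : t ∉ T' := by rw [hT']; simp
  have hT : T = insert t T' := by rw [hT']; simp [Set.insert_eq_of_mem ht]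
  rw [← hT'] at h ⊢
  have htX : t ≠ X := by rintro rfl; exact hX ht
  have htY : t ≠ Y := by rintro rfl; exact hY ht
  have hXT : ({X} ∪ T : Set I) = insert t ({X} ∪ T') := by
    rw [hT]; ext i; simp only [Set.mem_union, Set.mem_singleton_iff, Set.mem_insert_iff]; tauto
  have hYXT : ({Y} ∪ ({X} ∪ T) : Set I) = insert t ({Y} ∪ ({X} ∪ T')) := by
    rw [hXT]; ext i; simp only [Set.mem_union, Set.mem_singleton_iff, Set.mem_insert_iff]; tauto
  have hup : ∀ (U : Set I) (a : α t), t ∉ U → prS q U (Function.update v t a) = prS q U v := by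
    intro U a htU
    apply prS_congr
    intro i hi
    have : i ≠ t := by rintro rfl; exact htU hi
    simp [this]
  have n1 : t ∉ ({X} ∪ T' : Set I) := by simp [htX, htT']
  have n2 : t ∉ ({Y} ∪ ({X} ∪ T') : Set I) := by simp [htX, htT', htY]
  unfold adjG condPr
  rw [hYXT, hXT]
  have s1 := prS_step q n1 v
  have s2 := prS_step q n2 v
  have s3 := prS_step q htT' v
  rw [← hT] at s3
  have p1 := (prS_pos hpos ({X} ∪ T') v)
  have p3 := (prS_pos hpos T' v)
  rcases h with h | h
  · rw [condIndep_iff hpos] at h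
    have : ∀ a : α t, prS q (insert t ({Y} ∪ ({X} ∪ T'))) (Function.update v t a) /
          prS q (insert t ({X} ∪ T')) (Function.update v t a) * prS q T (Function.update v t a)
        = prS q (insert t ({Y} ∪ ({X} ∪ T'))) (Function.update v t a) *
          (prS q T' v / prS q ({X} ∪ T') v) := by
      intro a
      have h1 := h (Function.update v t a)
      rw [hup T' a htT', hup ({X} ∪ T') a n1,
        show ({X} ∪ {t} ∪ T' : Set I) = insert t ({X} ∪ T') by
          ext i; simp only [Set.mem_union, Set.mem_singleton_iff, Set.mem_insert_iff]; tauto,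
        show ({t} ∪ T' : Set I) = T by rw [hT]; rfl] at h1
      have p2 := (prS_pos hpos (insert t ({X} ∪ T')) (Function.update v t a))
      field_simp
      linear_combination (-prS q (insert t ({Y} ∪ ({X} ∪ T'))) (Function.update v t a)) * h1
    simp only [this]
    rw [← Finset.sum_mul, ← s2]
    field_simp
  · rw [condIndep_iff hpos] at h
    have : ∀ a : α t, prS q (insert t ({Y} ∪ ({X} ∪ T'))) (Function.update v t a) /
          prS q (insert t ({X} ∪ T')) (Function.update v t a) * prS q T (Function.update v t a)
        = (prS q ({Y} ∪ ({X} ∪ T')) v / prS q ({X} ∪ T') v) *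
            prS q T (Function.update v t a) := by
      intro a
      have h1 := h (Function.update v t a)
      rw [show ({Y} ∪ {t} ∪ (T' ∪ {X}) : Set I) = insert t ({Y} ∪ ({X} ∪ T')) by
          ext i; simp only [Set.mem_union, Set.mem_singleton_iff, Set.mem_insert_iff]; tauto,
        show ({t} ∪ (T' ∪ {X}) : Set I) = insert t ({X} ∪ T') by
          ext i; simp only [Set.mem_union, Set.mem_singleton_iff, Set.mem_insert_iff]; tauto,
        Set.union_comm T' {X}, hup ({X} ∪ T') a n1, hup _ a n2] at h1
      have p2 := (prS_pos hpos (insert t ({X} ∪ T')) (Function.update v t a))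
      congr 1
      field_simp
      linarith
    simp only [this]
    rw [← Finset.mul_sum, ← s3]

/-- if a separation holds in the DAG (equivalently in a faithful `p`), the vertex may be
removed from the adjustment set. -/
theorem isAdj_remove {E : I → I → Prop} (hdag : Irreflexive (Relation.TransGen E))
    {p : (∀ i, α i) → ℝ} (hfaith : Faithful p E) {X Y t : I} {T : Set I} (hXY : X ≠ Y)
    (hX : X ∉ T) (hY : Y ∉ T) (ht : t ∈ T)
    (h : CondIndep p {X} {t} (T \ {t}) ∨ CondIndep p {Y} {t} ((T \ {t}) ∪ {X}))
    (hadj : IsAdjustmentSet (α := α) E {X} {Y} T) :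
    IsAdjustmentSet (α := α) E {X} {Y} (T \ {t}) := by
  have htX : t ≠ X := by rintro rfl; exact hX ht
  have htY : t ≠ Y := by rintro rfl; exact hY ht
  have trans : ∀ (a : I) (S : Set I), a ≠ t → a ∉ S → t ∉ S → CondIndep p {a} {t} S →
      ∀ q : (∀ i, α i) → ℝ, (∀ v, 0 < q v) → MarkovCompat q E → CondIndep q {a} {t} S := by
    intro a S hat haS htS hci q hpos hmk
    rw [hfaith {a} {t} S (by simpa using hat) (by
      rw [Set.disjoint_right]; rintro i (rfl | rfl) <;> assumption)] at hci
    have := (mconn_iff_not_dsep hdag haS htS hat).not.2 (not_not.2 hci)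
    rw [condIndep_iff hpos]
    intro x
    have hs := sound hdag (mech_of_markov hdag hpos) haS this x
    rwa [jp_of_markov hmk] at hs
  rw [isAdj_iff] at hadj ⊢
  intro q hq hpos hmk x y
  rw [hadj q hq hpos hmk]
  refine adj_remove hpos hX hY ht ?_ _
  rcases h with h | h
  · exact Or.inl (trans X _ htX.symm (fun h => hX h.1) (by simp) h q hpos hmk)
  · exact Or.inr (trans Y _ htY.symm (by simp [hY, hXY.symm]) (by simp [htX]) h q hpos hmk)

end Adj

section Poly

open Polynomial in
lemma poly_zero_of_Ioo {P : ℝ[X]} (h : ∀ ε : ℝ, 0 < ε → ε < 1 → P.eval ε = 0) : P = 0 := by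
  apply Polynomial.eq_zero_of_infinite_isRoot
  refine (Set.Ioo_infinite (show (0 : ℝ) < 1 by norm_num)).mono ?_
  rintro ε ⟨h0, h1⟩
  exact h ε h0 h1

open Polynomial in
lemma pole_lemma {ι : Type*} (s : Finset ι) (a b e : ι → ℝ) (ha : ∀ w, 0 < a w)
    (hb : ∀ w, 0 < b w) {w0 : ι} (hw0 : w0 ∈ s)
    (h : ∀ ε : ℝ, 0 < ε → ε < 1 → ∑ w ∈ s, e w / (a w + ε * b w) = 0)
    (hne : ∀ w ∈ s, w ≠ w0 → a w * b w0 ≠ b w * a w0) : e w0 = 0 := by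
  let P : ℝ[X] := ∑ w ∈ s, C (e w) * ∏ w' ∈ s.erase w, (C (a w') + X * C (b w'))
  have hP : P = 0 := by
    apply poly_zero_of_Ioo
    intro ε h0 h1
    have hpos : ∀ w, 0 < a w + ε * b w := fun w => by
      have := ha w; have := mul_pos h0 (hb w); linarith
    have : P.eval ε = (∏ w ∈ s, (a w + ε * b w)) * ∑ w ∈ s, e w / (a w + ε * b w) := by
      simp only [P, eval_finset_sum, eval_mul, eval_C, eval_prod, eval_add, eval_X]
      rw [Finset.mul_sum]
      refine Finset.sum_congr rfl fun w hw => ?_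
      rw [← Finset.mul_prod_erase s _ hw]
      have := (hpos w).ne'
      field_simp
    rw [this, h ε h0 h1, mul_zero]
  have hev : P.eval (-(a w0 / b w0)) = 0 := by rw [hP]; simp
  simp only [P, eval_finset_sum, eval_mul, eval_C, eval_prod, eval_add, eval_X] at hev
  rw [Finset.sum_eq_single_of_mem w0 hw0] at hev
  · rcases mul_eq_zero.1 hev with h | h
    · exact h
    · exfalso
      obtain ⟨w, hw, hw'⟩ := Finset.prod_eq_zero_iff.1 h
      rw [Finset.mem_erase] at hw
      apply hne w hw.2 hw.1
      have := (hb w0).ne'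
      field_simp at hw'
      linarith
  · intro w hw hww
    rw [Finset.prod_eq_zero (i := w0) (Finset.mem_erase.2 ⟨hww.symm, hw0⟩), mul_zero]
    have := (hb w0).ne'
    field_simp
    ring

variable {κ : Type*}

/-- segment between two real functions -/
def mix (s : ℝ) (θ θ' : κ → ℝ) : κ → ℝ := fun i => (1 - s) * θ i + s * θ' i

/-- functions polynomial along segments -/
def PolyFn (F : (κ → ℝ) → ℝ) : Prop :=
  ∀ θ θ', ∃ P : Polynomial ℝ, ∀ s, F (mix s θ θ') = P.eval s

lemma PolyFn.const (c : ℝ) : PolyFn (fun _ : κ → ℝ => c) := fun _ _ =>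
  ⟨Polynomial.C c, by simp⟩

lemma PolyFn.coord (k : κ) : PolyFn (fun θ : κ → ℝ => θ k) := fun θ θ' =>
  ⟨(1 - Polynomial.X) * Polynomial.C (θ k) + Polynomial.X * Polynomial.C (θ' k), by
    intro s; simp [mix]; ring⟩

lemma PolyFn.mul {F G : (κ → ℝ) → ℝ} (hF : PolyFn F) (hG : PolyFn G) :
    PolyFn (fun θ => F θ * G θ) := fun θ θ' => by
  obtain ⟨P, hP⟩ := hF θ θ'
  obtain ⟨Q, hQ⟩ := hG θ θ'
  exact ⟨P * Q, by simp [hP, hQ]⟩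

lemma PolyFn.sub {F G : (κ → ℝ) → ℝ} (hF : PolyFn F) (hG : PolyFn G) :
    PolyFn (fun θ => F θ - G θ) := fun θ θ' => by
  obtain ⟨P, hP⟩ := hF θ θ'
  obtain ⟨Q, hQ⟩ := hG θ θ'
  exact ⟨P - Q, by simp [hP, hQ]⟩

lemma PolyFn.sum {ι : Type*} (s : Finset ι) {F : ι → (κ → ℝ) → ℝ} (hF : ∀ i, PolyFn (F i)) :
    PolyFn (fun θ => ∑ i ∈ s, F i θ) := fun θ θ' => by
  choose P hP using fun i => hF i θ θ'
  exact ⟨∑ i ∈ s, P i, by simp [hP, Polynomial.eval_finset_sum]⟩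

lemma PolyFn.prod {ι : Type*} (s : Finset ι) {F : ι → (κ → ℝ) → ℝ} (hF : ∀ i, PolyFn (F i)) :
    PolyFn (fun θ => ∏ i ∈ s, F i θ) := fun θ θ' => by
  choose P hP using fun i => hF i θ θ'
  exact ⟨∏ i ∈ s, P i, by simp [hP, Polynomial.eval_prod]⟩

lemma generic_point (Cs : Set (κ → ℝ)) (hC : ∀ θ ∈ Cs, ∀ θ' ∈ Cs, ∀ s : ℝ, 0 < s → s < 1 →
    mix s θ θ' ∈ Cs) (hne : Cs.Nonempty) {ι : Type*} (F : ι → (κ → ℝ) → ℝ) (s : Finset ι)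
    (hF : ∀ i ∈ s, PolyFn (F i)) (hex : ∀ i ∈ s, ∃ θ ∈ Cs, F i θ ≠ 0) :
    ∃ θ ∈ Cs, ∀ i ∈ s, F i θ ≠ 0 := by
  induction s using Finset.induction_on with
  | empty => obtain ⟨θ, h⟩ := hne; exact ⟨θ, h, by simp⟩
  | insert k s hk ih =>
    obtain ⟨θ1, h1, h1'⟩ := ih (fun i hi => hF i (Finset.mem_insert_of_mem hi))
      (fun i hi => hex i (Finset.mem_insert_of_mem hi))
    obtain ⟨θ2, h2, h2'⟩ := hex k (Finset.mem_insert_self _ _)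
    have hm1 : mix 1 θ1 θ2 = θ2 := by funext i; simp [mix]
    have hm0 : mix 0 θ1 θ2 = θ1 := by funext i; simp [mix]
    have key : ∀ i : ι, ∃ P : Polynomial ℝ, i ∈ insert k s →
        (P ≠ 0 ∧ ∀ r, F i (mix r θ1 θ2) = P.eval r) := by
      intro i
      by_cases hi : i ∈ insert k s
      · obtain ⟨P, hP⟩ := hF i hi θ1 θ2
        refine ⟨P, fun _ => ⟨?_, hP⟩⟩
        rintro rfl
        rcases Finset.mem_insert.1 hi with rfl | hi'
        · apply h2'
          have := hP 1
          simpa [hm1] using this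
        · apply h1' i hi'
          have := hP 0
          simpa [hm0] using this
      · exact ⟨0, fun h => absurd h hi⟩
    choose P hP using key
    by_contra hcon
    push Not at hcon
    have h0 : ∏ i ∈ insert k s, P i = 0 := by
      apply poly_zero_of_Ioo
      intro ε e0 e1
      obtain ⟨i, hi, hi'⟩ := hcon (mix ε θ1 θ2) (hC _ h1 _ h2 ε e0 e1)
      rw [Polynomial.eval_prod]
      apply Finset.prod_eq_zero hi
      rw [← (hP i hi).2, hi']
    obtain ⟨i, hi, hi'⟩ := Finset.prod_eq_zero_iff.1 h0
    exact (hP i hi).1 hi'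

end Poly

section SMech

/-- replace the mechanisms in `K` by two-level ones. -/
noncomputable def sMech (K : Set I) (x0 : ∀ i, α i) (g θ : I → (∀ i, α i) → ℝ) :
    I → (∀ i, α i) → ℝ := fun i v =>
  if i ∈ K then (if v i = x0 i then g i v else (1 - g i v) / ((Fintype.card (α i) : ℝ) - 1))
  else θ i v

lemma not_self_edge {E : I → I → Prop} (hdag : Irreflexive (Relation.TransGen E)) {i j : I}
    (h : E j i) : j ≠ i := by
  rintro rfl; exact hdag j (Relation.TransGen.single h)

lemma sMech_mech {E : I → I → Prop} (hdag : Irreflexive (Relation.TransGen E)) {K : Set I}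
    {x0 : ∀ i, α i} {g θ : I → (∀ i, α i) → ℝ}
    (hθ : ∀ i ∉ K, (∀ (v w : ∀ i, α i), v i = w i → (∀ j, E j i → v j = w j) → θ i v = θ i w) ∧
      ∀ (v : ∀ i, α i), ∑ a : α i, θ i (Function.update v i a) = 1)
    (hg : ∀ i ∈ K, ∀ (v w : ∀ i, α i), (∀ j, E j i → v j = w j) → g i v = g i w)
    (hc : ∀ i ∈ K, 1 < Fintype.card (α i)) : Mech E (sMech K x0 g θ) where
  dep := by
    intro i v w hi hpa
    unfold sMech
    split_ifs with hK h1 h2 h2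
    · exact hg i hK v w hpa
    · exact absurd (hi ▸ h1) h2
    · exact absurd (hi ▸ h2) h1
    · rw [hg i hK v w hpa]
    · exact (hθ i hK).1 v w hi hpa
  sum := by
    intro i v
    unfold sMech
    by_cases hK : i ∈ K
    · have e1 : ∀ a, g i (Function.update v i a) = g i v := fun a =>
        hg i hK _ _ fun j hj => by simp [not_self_edge hdag hj]
      simp only [hK, if_true, e1, Function.update_self]
      rw [Finset.sum_ite, Finset.sum_const, Finset.sum_const]
      have c1 : (Finset.univ.filter fun a : α i => a = x0 i).card = 1 := by
        rw [Finset.card_eq_one]; exact ⟨x0 i, by ext; simp⟩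
      have c2 : (Finset.univ.filter fun a : α i => ¬ a = x0 i).card = Fintype.card (α i) - 1 := by
        rw [Finset.filter_ne' , Finset.card_erase_of_mem (Finset.mem_univ _)]; rfl
      rw [c1, c2]
      have := hc i hK
      have h2 : (1 : ℝ) < Fintype.card (α i) := by exact_mod_cast this
      have h3 : (Fintype.card (α i) : ℝ) - 1 ≠ 0 := by linarith
      rw [nsmul_eq_mul, nsmul_eq_mul, Nat.cast_sub this.le]
      push_cast
      field_simp
      ring
    · simp only [hK, if_false]
      exact (hθ i hK).2 v

lemma sMech_pos {K : Set I} {x0 : ∀ i, α i} {g θ : I → (∀ i, α i) → ℝ}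
    (hθ : ∀ i ∉ K, ∀ v, 0 < θ i v) (hg : ∀ i ∈ K, ∀ v, 0 < g i v ∧ g i v < 1)
    (hc : ∀ i ∈ K, 1 < Fintype.card (α i)) (i : I) (v : ∀ i, α i) : 0 < sMech K x0 g θ i v := by
  unfold sMech
  split_ifs with hK h1
  · exact (hg i hK v).1
  · have := hc i hK
    have h2 : (1 : ℝ) < Fintype.card (α i) := by exact_mod_cast this
    exact div_pos (by linarith [(hg i hK v).2]) (by linarith)
  · exact hθ i hK v

lemma mech_le_one {E : I → I → Prop} {θ : I → (∀ i, α i) → ℝ} (hθ : Mech E θ)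
    (hpos : ∀ i v, 0 < θ i v) (i : I) (v : ∀ i, α i) : θ i v ≤ 1 := by
  rw [← hθ.sum i v]
  have := Finset.single_le_sum (f := fun a : α i => θ i (Function.update v i a))
    (fun a _ => (hpos i _).le) (Finset.mem_univ (v i))
  simpa using this

/-- product of all mechanisms but one -/
noncomputable def dj (θ : I → (∀ i, α i) → ℝ) (X : I) (v : ∀ i, α i) : ℝ :=
  ∏ i ∈ Finset.univ.erase X, θ i v

lemma jp_eq_dj (θ : I → (∀ i, α i) → ℝ) (X : I) (v : ∀ i, α i) :
    jp θ v = θ X v * dj θ X v := by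
  unfold jp dj
  exact (Finset.mul_prod_erase Finset.univ (fun i => θ i v) (Finset.mem_univ X)).symm

lemma dj_congr {θ θ' : I → (∀ i, α i) → ℝ} {X : I} (h : ∀ i, i ≠ X → ∀ v, θ i v = θ' i v) :
    dj θ X = dj θ' X := by
  funext v
  exact Finset.prod_congr rfl fun i hi => h i (Finset.ne_of_mem_erase hi) v

lemma dj_pos {θ : I → (∀ i, α i) → ℝ} (hpos : ∀ i v, 0 < θ i v) (X : I) (v : ∀ i, α i) :
    0 < dj θ X v := Finset.prod_pos fun i _ => hpos i v

lemma doPMF_jp {E : I → I → Prop} (hdag : Irreflexive (Relation.TransGen E))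
    {θ : I → (∀ i, α i) → ℝ} (hθ : Mech E θ) (hpos : ∀ i v, 0 < θ i v) (X : I) (x v : ∀ i, α i) :
    doPMF (jp θ) E {X} x v = if v X = x X then dj θ X v else 0 := by
  unfold doPMF
  simp only [jp_markov hdag hθ hpos, Set.mem_singleton_iff, forall_eq]
  split_ifs with h
  · unfold dj
    rw [← finprod_mem_coe_finset]
    congr! 2
    simp
  · rfl

lemma prS_nondesc {E : I → I → Prop} (hdag : Irreflexive (Relation.TransGen E))
    {θ θ' : I → (∀ i, α i) → ℝ} (hθ : Mech E θ) (hθ' : Mech E θ') {X : I} {Z : Set I}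
    (h : ∀ i, i ≠ X → ∀ v, θ i v = θ' i v) (hanc : ∀ z ∈ Z, ¬ Anc E X z) (x : ∀ i, α i) :
    prS (jp θ) Z x = prS (jp θ') Z x := by
  have hM : ∀ i ∈ {j | ¬ Anc E X j}, ∀ j, E j i → j ∈ {j | ¬ Anc E X j} := by
    intro i hi j hj hc
    exact hi (Relation.ReflTransGen.tail hc hj)
  refine prS_eq_of_superset (W := {j | ¬ Anc E X j}) hanc ?_ x
  intro v
  rw [prS_anc hdag hθ hM, prS_anc hdag hθ' hM]
  unfold jpOn
  refine Finset.prod_congr rfl fun i _ => ?_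
  split_ifs with hi
  · apply h
    rintro rfl
    exact hi Relation.ReflTransGen.refl
  · rfl

lemma prS_do_eq {E : I → I → Prop} (hdag : Irreflexive (Relation.TransGen E))
    {θ : I → (∀ i, α i) → ℝ} (hθ : Mech E θ) {X : I} {Z : Set I}
    (hanc : ∀ z ∈ Z, ¬ Anc E X z) (x : ∀ i, α i) :
    prS (dj θ X) ({X} ∪ Z) x = prS (jp θ) Z x := by
  let θ' : I → (∀ i, α i) → ℝ := fun i v =>
    if i = X then (if v i = x i then 1 else 0) else θ i v
  have hθ' : Mech E θ' := by
    constructor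
    · intro i v w hi hpa
      by_cases hX : i = X
      · simp [θ', hX]
        subst hX
        rw [hi]
      · simp [θ', hX, hθ.dep i v w hi hpa]
    · intro i v
      by_cases hX : i = X
      · subst hX; simp [θ']
      · simp [θ', hX, hθ.sum]
  have hag : ∀ i, i ≠ X → ∀ v, θ i v = θ' i v := by
    intro i hi v; simp [θ', hi]
  rw [prS_nondesc hdag hθ hθ' hag hanc, dj_congr hag, Set.singleton_union,
    ← prS_insert_of_zero (jp θ') Z X x]
  · apply prS_congr_fun
    intro v hv
    have := hv X (Or.inl rfl)
    rw [jp_eq_dj θ' X]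
    simp [θ', this]
  · intro v hv
    rw [jp_eq_dj θ' X]
    simp [θ', hv]

end SMech

section KeyB

lemma xmech {E : I → I → Prop} (hdag : Irreflexive (Relation.TransGen E))
    {θ : I → (∀ i, α i) → ℝ} (hθ : Mech E θ) (hpos : ∀ i v, 0 < θ i v) {X : I}
    (hcard : 1 < Fintype.card (α X)) (x0 : ∀ i, α i) (g : (∀ i, α i) → ℝ)
    (hg : ∀ v w : (∀ i, α i), (∀ j, E j X → v j = w j) → g v = g w)
    (hg01 : ∀ v, 0 < g v ∧ g v < 1) :
    Mech E (sMech {X} x0 (fun _ => g) θ) ∧ (∀ i v, 0 < sMech {X} x0 (fun _ => g) θ i v) ∧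
    (∀ i, i ≠ X → ∀ v, sMech {X} x0 (fun _ => g) θ i v = θ i v) ∧
    ∀ v : (∀ i, α i), v X = x0 X → sMech {X} x0 (fun _ => g) θ X v = g v := by
  refine ⟨sMech_mech hdag (fun i _ => ⟨hθ.dep i, hθ.sum i⟩) ?_ ?_,
    sMech_pos (fun i _ => hpos i) (fun i _ => hg01) ?_, ?_, ?_⟩
  · rintro i rfl; exact hg
  · rintro i rfl; exact hcard
  · rintro i rfl; exact hcard
  · intro i hi v; simp [sMech, hi]
  · intro v hv; simp [sMech, hv]

lemma pole_step {E : I → I → Prop} (hdag : Irreflexive (Relation.TransGen E))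
    {θ : I → (∀ i, α i) → ℝ} (hθ : Mech E θ) (hpos : ∀ i v, 0 < θ i v) {X Y : I} {Z : Set I}
    (hXZ : X ∉ Z) (hYZ : Y ∉ Z) (hanc : ∀ z ∈ Z, ¬ Anc E X z)
    (hcard : 1 < Fintype.card (α X)) (hadj : IsAdjustmentSet (α := α) E {X} {Y} Z)
    (v0 : ∀ i, α i)
    (hne : ∀ w : (∀ i, α i), (∀ i ∈ Zᶜ, w i = v0 i) → w ≠ v0 →
      prS (jp θ) Z w * prS (jp θ) ({X} ∪ Z) v0 ≠ prS (jp θ) ({X} ∪ Z) w * prS (jp θ) Z v0) :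
    prS (jp θ) Z v0 * prS (jp θ) ({Y} ∪ ({X} ∪ Z)) v0 =
      prS (jp θ) ({X} ∪ Z) v0 * prS (dj θ X) ({Y} ∪ ({X} ∪ Z)) v0 := by
  have hjp := jp_pos hpos
  rw [← sub_eq_zero]
  refine pole_lemma (Finset.univ.filter fun w : (∀ i, α i) => ∀ i ∈ Zᶜ, w i = v0 i)
    (fun w => prS (jp θ) Z w) (fun w => prS (jp θ) ({X} ∪ Z) w)
    (fun w => prS (jp θ) Z w * prS (jp θ) ({Y} ∪ ({X} ∪ Z)) w -
      prS (jp θ) ({X} ∪ Z) w * prS (dj θ X) ({Y} ∪ ({X} ∪ Z)) w)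
    (fun w => prS_pos hjp _ _) (fun w => prS_pos hjp _ _) (w0 := v0) (by simp) ?_ ?_
  swap
  · intro w hw
    exact hne w (by simpa using hw)
  intro ε h0 h1
  obtain ⟨hm, hp, hoff, hX⟩ := xmech hdag hθ hpos hcard v0
    (fun v => (1 + ε * θ X (Function.update v X (v0 X))) / 4) (by
      intro v w h
      rw [hθ.dep X (Function.update v X (v0 X)) (Function.update w X (v0 X)) (by simp)
        (fun j hj => by simp [not_self_edge hdag hj, h j hj])]) (by
      intro v
      have a1 := hpos X (Function.update v X (v0 X))
      have a2 := mech_le_one hθ hpos X (Function.update v X (v0 X))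
      have a3 := mul_pos h0 a1
      constructor
      · linarith
      · nlinarith)
  set θ' := sMech {X} v0 (fun _ v => (1 + ε * θ X (Function.update v X (v0 X))) / 4) θ with hθ'
  have hadj' := (isAdj_iff E {X} {Y} Z).1 hadj (jp θ') (jp_pmf hdag hm hp) (jp_pos hp)
    (jp_markovCompat hdag hm hp) v0 v0
  have hjp' : ∀ v : (∀ i, α i), v X = v0 X → jp θ' v = (1 / 4) * (dj θ X v + ε * jp θ v) := by
    intro v hv
    have : Function.update v X (v0 X) = v := by rw [← hv]; simp
    rw [jp_eq_dj θ' X, hX v hv, dj_congr hoff, jp_eq_dj θ X, this]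
    ring
  have hprS : ∀ (U : Set I) (w : ∀ i, α i), X ∈ U → w X = v0 X →
      prS (jp θ') U w = (1 / 4) * (prS (dj θ X) U w + ε * prS (jp θ) U w) := by
    intro U w hU hw
    rw [← prS_mul_left ε, ← prS_add, ← prS_mul_left]
    apply prS_congr_fun
    intro v hv
    exact hjp' v (by rw [hv X hU, hw])
  have hdo : prS (doPMF (jp θ') E {X} v0) {Y} v0 =
      prS (fun w => prS (dj θ X) ({Y} ∪ ({X} ∪ Z)) w) Zᶜ v0 := by
    rw [← prS_tower (doPMF (jp θ') E {X} v0) (U := {Y}) (Z := Z) (by rintro _ rfl; exact hYZ) v0]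
    apply prS_congr_fun
    intro w hw
    have hwX : w X = v0 X := hw X hXZ
    rw [← prS_insert_of_zero _ _ X, show insert X ({Y} ∪ Z) = {Y} ∪ ({X} ∪ Z) by
      ext i; simp only [Set.mem_union, Set.mem_singleton_iff, Set.mem_insert_iff]; tauto]
    · apply prS_congr_fun
      intro v hv
      have : v X = v0 X := by rw [hv X (Or.inr (Or.inl rfl)), hwX]
      rw [doPMF_jp hdag hm hp, if_pos this, dj_congr hoff]
    · intro v hv
      rw [hwX] at hv
      rw [doPMF_jp hdag hm hp, if_neg hv]
  rw [hdo] at hadj'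
  simp only [ite_self] at hadj'
  rw [prS_eq_filter, prS_eq_filter, ← sub_eq_zero, ← Finset.sum_sub_distrib] at hadj'
  have hε : -ε ≠ 0 := by linarith
  rw [← mul_right_inj' hε, mul_zero, ← hadj', Finset.mul_sum]
  refine Finset.sum_congr (by congr!) fun w hw => ?_
  have hw' : ∀ i ∈ Zᶜ, w i = v0 i := by simpa using hw
  have hwX : w X = v0 X := hw' X hXZ
  unfold adjG condPr
  rw [hprS _ w (Or.inr (Or.inl rfl)) hwX, hprS _ w (Or.inl rfl) hwX, prS_do_eq hdag hθ hanc,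
    prS_nondesc hdag hm hθ hoff hanc]
  have a1 := prS_pos hjp Z w
  have a2 := mul_pos h0 (prS_pos hjp ({X} ∪ Z) w)
  have a3 : prS (jp θ) Z w + ε * prS (jp θ) ({X} ∪ Z) w ≠ 0 := by linarith
  field_simp
  ring

lemma prS_ite_coord (f : (∀ i, α i) → ℝ) (A : I) (S : Set I) (x : ∀ i, α i) :
    prS (fun v => if v A = x A then f v else 0) S x = prS f (insert A S) x := by
  rw [← prS_insert_of_zero _ S A]
  · apply prS_congr_fun
    intro v hv
    rw [if_pos (hv A (Or.inl rfl))]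
  · intro v hv; rw [if_neg hv]

lemma exists_F0 {E : I → I → Prop} (hdag : Irreflexive (Relation.TransGen E))
    {θ : I → (∀ i, α i) → ℝ} (hθ : Mech E θ) (hpos : ∀ i v, 0 < θ i v) {X Y A : I} {Z : Set I}
    (hanc : ∀ z ∈ Z, ¬ Anc E X z) (hA : E A X)
    (hcard : 1 < Fintype.card (α X)) (v0 : ∀ i, α i)
    (hne : prS (jp θ) (insert A ({Y} ∪ ({X} ∪ Z))) v0 * prS (jp θ) ({X} ∪ Z) v0 ≠
      prS (jp θ) (insert A ({X} ∪ Z)) v0 * prS (jp θ) ({Y} ∪ ({X} ∪ Z)) v0) :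
    ∃ θ' : I → (∀ i, α i) → ℝ, Mech E θ' ∧ (∀ i v, 0 < θ' i v) ∧
      prS (jp θ') Z v0 * prS (jp θ') ({Y} ∪ ({X} ∪ Z)) v0 -
      prS (jp θ') ({X} ∪ Z) v0 * prS (dj θ' X) ({Y} ∪ ({X} ∪ Z)) v0 ≠ 0 := by
  by_contra hcon
  push Not at hcon
  have h1 := hcon θ hθ hpos
  obtain ⟨hm, hp, hoff, hX⟩ := xmech hdag hθ hpos hcard v0
    (fun v => (θ X (Function.update v X (v0 X)) * (1 + if v A = v0 A then 1 else 0)) / 4) (by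
      intro v w h
      rw [hθ.dep X (Function.update v X (v0 X)) (Function.update w X (v0 X)) (by simp)
        (fun j hj => by simp [not_self_edge hdag hj, h j hj]), h A hA]) (by
      intro v
      have a1 := hpos X (Function.update v X (v0 X))
      have a2 := mech_le_one hθ hpos X (Function.update v X (v0 X))
      split_ifs <;> constructor <;> linarith)
  have h2 := hcon _ hm hp
  set θ' := sMech {X} v0
    (fun _ v => (θ X (Function.update v X (v0 X)) * (1 + if v A = v0 A then 1 else 0)) / 4) θ
    with hθ'
  have hjp' : ∀ v : (∀ i, α i), v X = v0 X →
      jp θ' v = (1 / 4) * (jp θ v + if v A = v0 A then jp θ v else 0) := by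
    intro v hv
    have : Function.update v X (v0 X) = v := by rw [← hv]; simp
    rw [jp_eq_dj θ' X, hX v hv, dj_congr hoff, jp_eq_dj θ X, this]
    split_ifs <;> ring
  have hprS : ∀ (U : Set I), X ∈ U →
      prS (jp θ') U v0 = (1 / 4) * (prS (jp θ) U v0 + prS (jp θ) (insert A U) v0) := by
    intro U hU
    rw [← prS_ite_coord, ← prS_add, ← prS_mul_left]
    apply prS_congr_fun
    intro v hv
    exact hjp' v (by rw [hv X hU])
  rw [hprS ({Y} ∪ ({X} ∪ Z)) (Or.inr (Or.inl rfl)), hprS ({X} ∪ Z) (Or.inl rfl), prS_nondesc hdag hm hθ hoff hanc,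
    dj_congr hoff] at h2
  apply hne
  have a1 := (prS_pos (jp_pos hpos) Z v0).ne'
  apply mul_left_cancel₀ a1
  linear_combination (4 * prS (jp θ) ({X} ∪ Z) v0) * h2 -
    (prS (jp θ) ({X} ∪ Z) v0 + prS (jp θ) (insert A ({X} ∪ Z)) v0) * h1

end KeyB

section KeyC

/-- coordinatewise transposition -/
noncomputable def swapv (x y v : ∀ i, α i) : ∀ i, α i := fun i => Equiv.swap (x i) (y i) (v i)

lemma swapv_swapv (x y v : ∀ i, α i) : swapv x y (swapv x y v) = v := by
  funext i; simp [swapv]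

lemma prS_swapv (f : (∀ i, α i) → ℝ) (S : Set I) (x y : ∀ i, α i) :
    prS (fun v => f (swapv x y v)) S x = prS f S y := by
  rw [prS_eq_filter, prS_eq_filter]
  refine Finset.sum_nbij' (swapv x y) (swapv x y) ?_ ?_ (fun v _ => swapv_swapv x y v)
    (fun v _ => swapv_swapv x y v) (fun v _ => rfl)
  · intro v hv
    simp only [Finset.mem_filter, Finset.mem_univ, true_and] at hv ⊢
    intro i hi
    simp [swapv, hv i hi]
  · intro v hv
    simp only [Finset.mem_filter, Finset.mem_univ, true_and] at hv ⊢
    intro i hi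
    simp [swapv, hv i hi]

lemma exists_small {G : ℝ → ℝ} (hG : Continuous G) (h0 : G 0 ≠ 0) :
    ∃ c : ℝ, 0 < c ∧ c < 1 ∧ G c ≠ 0 := by
  have h1 : ∀ᶠ c in nhds (0 : ℝ), G c ≠ 0 := hG.continuousAt.eventually_ne h0
  obtain ⟨δ, hδ, h⟩ := Metric.eventually_nhds_iff.1 h1
  refine ⟨min (δ / 2) (1 / 2), by positivity, ?_, ?_⟩
  · exact lt_of_le_of_lt (min_le_right _ _) (by norm_num)
  · apply h
    rw [Real.dist_eq, sub_zero, abs_of_pos (by positivity)]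
    exact lt_of_le_of_lt (min_le_left _ _) (by linarith)

/-- product of the mechanisms outside `K` -/
noncomputable def dK (θ : I → (∀ i, α i) → ℝ) (K : Set I) (v : ∀ i, α i) : ℝ :=
  ∏ i, if i ∈ K then 1 else θ i v

lemma exists_Fw_aux {E : I → I → Prop} (hdag : Irreflexive (Relation.TransGen E))
    {θ : I → (∀ i, α i) → ℝ} (hθ : Mech E θ) (hpos : ∀ i v, 0 < θ i v) {X : I} {Z : Set I}
    (v0 w u û : ∀ i, α i) (hw : ∀ i ∈ Zᶜ, w i = v0 i)
    (hu : ∀ i, w i = v0 i → û i = u i)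
    (hne : prS (jp θ) ({X} ∪ Z) û * prS (dK θ {i | w i ≠ v0 i}) Z u ≠
      prS (dK θ {i | w i ≠ v0 i}) ({X} ∪ Z) u * prS (jp θ) Z û) :
    ∃ θ' : I → (∀ i, α i) → ℝ, Mech E θ' ∧ (∀ i v, 0 < θ' i v) ∧
      prS (jp θ') Z w * prS (jp θ') ({X} ∪ Z) v0 - prS (jp θ') ({X} ∪ Z) w * prS (jp θ') Z v0
        ≠ 0 := by
  set K : Set I := {i | w i ≠ v0 i} with hK
  have hKZ : ∀ i ∈ K, i ∈ Z := by
    intro i hi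
    by_contra h
    exact hi (hw i h)
  have hoffK : ∀ i, i ∉ K → w i = v0 i := by
    intro i hi; by_contra h; exact hi h
  let τ : (∀ i, α i) → (∀ i, α i) := fun v i =>
    if i ∈ K then (if v i = v0 i then û i else u i) else Equiv.swap (v0 i) (û i) (v i)
  let ψ : I → (∀ i, α i) → ℝ := fun i v => θ i (τ (Function.update v i (v0 i)))
  have hψ : ∀ i v, 0 < ψ i v ∧ ψ i v ≤ 1 := fun i v => ⟨hpos _ _, mech_le_one hθ hpos _ _⟩
  let cd : I → ℝ := fun i => (Fintype.card (α i) : ℝ) - 1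
  have hcard : ∀ i ∈ K, 1 < Fintype.card (α i) := by
    intro i hi
    exact Fintype.one_lt_card_iff.2 ⟨w i, v0 i, hi⟩
  have hcd : ∀ i ∈ K, cd i ≠ 0 := by
    intro i hi
    have h2 : (1 : ℝ) < Fintype.card (α i) := by exact_mod_cast hcard i hi
    simp only [cd]; linarith
  let H : ℝ → (∀ i, α i) → ℝ := fun c v =>
    ∏ i, if i ∈ K then (1 - c * ψ i v) / cd i else θ i (τ v)
  let κ0 : ℝ := ∏ i, if i ∈ K then 1 / cd i else 1
  have hκ0 : κ0 ≠ 0 := by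
    refine Finset.prod_ne_zero_iff.2 fun i _ => ?_
    split_ifs with h
    · exact one_div_ne_zero (hcd i h)
    · exact one_ne_zero
  -- τ on the two slices
  have hτ0 : ∀ v : (∀ i, α i), (∀ i ∈ Z, v i = v0 i) → τ v = swapv v0 û v := by
    intro v hv
    funext i
    by_cases hi : i ∈ K
    · simp [τ, swapv, hi, hv i (hKZ i hi)]
    · simp [τ, swapv, hi]
  have hτw : ∀ v : (∀ i, α i), (∀ i ∈ Z, v i = w i) → τ v = swapv w u v := by
    intro v hv
    funext i
    by_cases hi : i ∈ K
    · have : w i ≠ v0 i := hi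
      simp [τ, swapv, hi, hv i (hKZ i hi), this]
    · simp [τ, swapv, hi, hoffK i hi, hu i (hoffK i hi)]
  have hH0 : ∀ S : Set I, Z ⊆ S → prS (H 0) S w = κ0 * prS (dK θ K) S u := by
    intro S hS
    rw [← prS_swapv (dK θ K) S w u, ← prS_mul_left]
    apply prS_congr_fun
    intro v hv
    rw [← hτw v (fun i hi => hv i (hS hi))]
    simp only [H, κ0, dK]
    rw [← Finset.prod_mul_distrib]
    refine Finset.prod_congr rfl fun i _ => ?_
    split_ifs <;> simp
  have hHc : ∀ S : Set I, Continuous fun c => prS (H c) S w := by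
    intro S
    simp only [prS_eq_sum]
    refine continuous_finset_sum _ fun v _ => ?_
    split_ifs
    · simp only [H]
      refine continuous_finset_prod _ fun i _ => ?_
      split_ifs
      · fun_prop
      · fun_prop
    · fun_prop
  obtain ⟨c, c0, c1, hc⟩ := exists_small
    (G := fun c => prS (H c) Z w * prS (jp θ) ({X} ∪ Z) û -
      prS (H c) ({X} ∪ Z) w * prS (jp θ) Z û) (by
      exact ((hHc Z).mul continuous_const).sub ((hHc _).mul continuous_const)) (by
      rw [hH0 Z subset_rfl, hH0 ({X} ∪ Z) Set.subset_union_right]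
      intro h
      apply hne
      apply mul_left_cancel₀ hκ0
      linear_combination h)
  have hdep : ∀ i ∉ K, (∀ (v w : ∀ i, α i), v i = w i → (∀ j, E j i → v j = w j) →
        θ i (τ v) = θ i (τ w)) ∧
      ∀ (v : ∀ i, α i), ∑ a : α i, θ i (τ (Function.update v i a)) = 1 := by
    intro i hi
    constructor
    · intro v w h h'
      apply hθ.dep
      · simp [τ, h]
      · intro j hj; simp [τ, h' j hj]
    · intro v
      have e1 : ∀ a, τ (Function.update v i a) =
          Function.update (τ v) i (Equiv.swap (v0 i) (û i) a) := by
        intro a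
        funext j
        by_cases hj : j = i
        · subst hj; simp [τ, hi]
        · simp [τ, hj]
      simp only [e1]
      rw [Equiv.sum_comp (Equiv.swap (v0 i) (û i))
        (fun a => θ i (Function.update (τ v) i a)), hθ.sum]
  have hgdep : ∀ i ∈ K, ∀ (v w : ∀ i, α i), (∀ j, E j i → v j = w j) →
      c * ψ i v = c * ψ i w := by
    intro i hi v w h
    congr 1
    apply hθ.dep
    · simp [τ]
    · intro j hj; simp [τ, h j hj, not_self_edge hdag hj]
  have hg01 : ∀ i ∈ K, ∀ v, 0 < c * ψ i v ∧ c * ψ i v < 1 := by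
    intro i _ v
    have := hψ i v
    constructor
    · exact mul_pos c0 this.1
    · nlinarith
  refine ⟨sMech K v0 (fun i v => c * ψ i v) (fun i v => θ i (τ v)),
    sMech_mech hdag hdep hgdep hcard, sMech_pos (fun i _ v => hpos _ _) hg01 hcard, ?_⟩
  let κ1 : ℝ := ∏ i, if i ∈ K then c else 1
  have hκ1 : κ1 ≠ 0 := by
    refine Finset.prod_ne_zero_iff.2 fun i _ => ?_
    split_ifs with h
    · exact c0.ne'
    · exact one_ne_zero
  have hS0 : ∀ S : Set I, Z ⊆ S →
      prS (jp (sMech K v0 (fun i v => c * ψ i v) (fun i v => θ i (τ v)))) S v0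
        = κ1 * prS (jp θ) S û := by
    intro S hS
    rw [← prS_swapv (jp θ) S v0 û, ← prS_mul_left]
    apply prS_congr_fun
    intro v hv
    rw [← hτ0 v (fun i hi => hv i (hS hi))]
    simp only [κ1, jp, sMech]
    rw [← Finset.prod_mul_distrib]
    refine Finset.prod_congr rfl fun i _ => ?_
    by_cases hi : i ∈ K
    · have h1 : v i = v0 i := hv i (hS (hKZ i hi))
      have h2 : Function.update v i (v0 i) = v := by rw [← h1]; simp
      simp only [hi, if_true, h1, ψ, h2]
    · simp only [hi, if_false, one_mul]
  have hSw : ∀ S : Set I, Z ⊆ S →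
      prS (jp (sMech K v0 (fun i v => c * ψ i v) (fun i v => θ i (τ v)))) S w
        = prS (H c) S w := by
    intro S hS
    apply prS_congr_fun
    intro v hv
    simp only [jp, sMech, H]
    refine Finset.prod_congr rfl fun i _ => ?_
    by_cases hi : i ∈ K
    · have h1 : v i ≠ v0 i := by rw [hv i (hS (hKZ i hi))]; exact hi
      simp only [hi, if_true, h1, if_false, cd]
    · simp only [hi, if_false]
  rw [hS0 Z subset_rfl, hS0 ({X} ∪ Z) Set.subset_union_right, hSw Z subset_rfl,
    hSw ({X} ∪ Z) Set.subset_union_right]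
  intro h
  apply mul_ne_zero hκ1 hc
  linear_combination h

lemma exists_Fw {E : I → I → Prop} (hdag : Irreflexive (Relation.TransGen E))
    {θ : I → (∀ i, α i) → ℝ} (hθ : Mech E θ) (hpos : ∀ i v, 0 < θ i v) {X : I} {Z : Set I}
    (hXZ : X ∉ Z) (v0 w : ∀ i, α i) (hw : ∀ i ∈ Zᶜ, w i = v0 i) (hwv : w ≠ v0)
    (hci : ∀ z ∈ Z, ¬ CondIndep (jp θ) {X} {z} (Z \ {z})) :
    ∃ θ' : I → (∀ i, α i) → ℝ, Mech E θ' ∧ (∀ i v, 0 < θ' i v) ∧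
      prS (jp θ') Z w * prS (jp θ') ({X} ∪ Z) v0 - prS (jp θ') ({X} ∪ Z) w * prS (jp θ') Z v0
        ≠ 0 := by
  have hjp := jp_pos hpos
  obtain ⟨j, hj⟩ : ∃ j, w j ≠ v0 j := by
    by_contra h; push Not at h; exact hwv (funext h)
  have hjZ : j ∈ Z := by by_contra h; exact hj (hw j h)
  have hXj : X ≠ j := by rintro rfl; exact hXZ hjZ
  -- the ratio b/a is not constant in the coordinate j
  obtain ⟨u, u', huu, hne⟩ : ∃ u u' : (∀ i, α i), (∀ i, i ≠ j → u' i = u i) ∧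
      prS (jp θ) ({X} ∪ Z) u * prS (jp θ) Z u' ≠ prS (jp θ) ({X} ∪ Z) u' * prS (jp θ) Z u := by
    by_contra hcon
    push Not at hcon
    apply hci j hjZ
    rw [condIndep_iff hjp]
    intro x
    have hZ : insert j (Z \ {j}) = Z := by simp [Set.insert_eq_of_mem hjZ]
    have e1 : ({X} ∪ {j} ∪ (Z \ {j}) : Set I) = {X} ∪ Z := by
      rw [Set.union_assoc, Set.singleton_union (s := Z \ {j}), hZ]
    have e2 : ({j} ∪ (Z \ {j}) : Set I) = Z := by rw [Set.singleton_union, hZ]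
    have e3 : insert j ({X} ∪ (Z \ {j}) : Set I) = {X} ∪ Z := by
      rw [← e1]; ext i; simp only [Set.mem_union, Set.mem_singleton_iff, Set.mem_insert_iff]; tauto
    rw [e1, e2, prS_step (jp θ) (U := Z \ {j}) (k := j) (by simp),
      prS_step (jp θ) (U := {X} ∪ (Z \ {j})) (k := j) (by simp [hXj.symm]), hZ, e3,
      Finset.mul_sum, Finset.sum_mul]
    refine Finset.sum_congr rfl fun a _ => ?_
    exact hcon x (Function.update x j a) (fun i hi => by simp [hi])
  have hD : 0 < prS (dK θ {i | w i ≠ v0 i}) Z u := by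
    apply prS_pos
    intro v
    refine Finset.prod_pos fun i _ => ?_
    split_ifs
    · exact one_pos
    · exact hpos i v
  by_cases h : prS (jp θ) ({X} ∪ Z) u * prS (dK θ {i | w i ≠ v0 i}) Z u =
      prS (dK θ {i | w i ≠ v0 i}) ({X} ∪ Z) u * prS (jp θ) Z u
  · refine exists_Fw_aux hdag hθ hpos v0 w u u' hw ?_ ?_
    · intro i hi
      apply huu
      rintro rfl
      exact hj hi
    · intro h'
      apply hne
      apply mul_left_cancel₀ hD.ne'
      linear_combination prS (jp θ) Z u' * h - prS (jp θ) Z u * h'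
  · exact exists_Fw_aux hdag hθ hpos v0 w u u hw (fun i _ => rfl) h

end KeyC

section KeyD

lemma polyFn_prS {f : (I × (∀ i, α i) → ℝ) → (∀ i, α i) → ℝ}
    (hf : ∀ v, PolyFn (fun Θ => f Θ v)) (S : Set I) (x : ∀ i, α i) :
    PolyFn (fun Θ => prS (f Θ) S x) := by
  simp only [prS_eq_sum]
  refine PolyFn.sum _ fun v => ?_
  split_ifs
  · exact hf v
  · exact PolyFn.const 0

lemma polyFn_jp (v : ∀ i, α i) :
    PolyFn (fun Θ : I × (∀ i, α i) → ℝ => jp (fun i v => Θ (i, v)) v) :=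
  PolyFn.prod _ fun i => PolyFn.coord (i, v)

lemma polyFn_dj (X : I) (v : ∀ i, α i) :
    PolyFn (fun Θ : I × (∀ i, α i) → ℝ => dj (fun i v => Θ (i, v)) X v) :=
  PolyFn.prod _ fun i => PolyFn.coord (i, v)

lemma mech_mix {E : I → I → Prop} {Θ Θ' : I × (∀ i, α i) → ℝ}
    (h : Mech E (fun i v => Θ (i, v))) (h' : Mech E (fun i v => Θ' (i, v))) (s : ℝ) :
    Mech E (fun i v => mix s Θ Θ' (i, v)) where
  dep := by
    intro i v w hi hpa
    have h1 : Θ (i, v) = Θ (i, w) := h.dep i v w hi hpa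
    have h2 : Θ' (i, v) = Θ' (i, w) := h'.dep i v w hi hpa
    simp only [mix, h1, h2]
  sum := by
    intro i v
    have h1 : ∑ a : α i, Θ (i, Function.update v i a) = 1 := h.sum i v
    have h2 : ∑ a : α i, Θ' (i, Function.update v i a) = 1 := h'.sum i v
    simp only [mix]
    rw [Finset.sum_add_distrib, ← Finset.mul_sum, ← Finset.mul_sum, h1, h2]
    ring

/-- the main analytic step -/
lemma keyB_analytic {E : I → I → Prop} (hdag : Irreflexive (Relation.TransGen E))
    {θ : I → (∀ i, α i) → ℝ} (hθ : Mech E θ) (hpos : ∀ i v, 0 < θ i v) {X Y A : I} {Z : Set I}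
    (hXZ : X ∉ Z) (hYZ : Y ∉ Z) (hanc : ∀ z ∈ Z, ¬ Anc E X z) (hA : E A X)
    (hcard : 1 < Fintype.card (α X)) (hadj : IsAdjustmentSet (α := α) E {X} {Y} Z)
    (hci : ∀ z ∈ Z, ¬ CondIndep (jp θ) {X} {z} (Z \ {z})) (v0 : ∀ i, α i) :
    prS (jp θ) (insert A ({Y} ∪ ({X} ∪ Z))) v0 * prS (jp θ) ({X} ∪ Z) v0 =
      prS (jp θ) (insert A ({X} ∪ Z)) v0 * prS (jp θ) ({Y} ∪ ({X} ∪ Z)) v0 := by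
  by_contra hne
  let F : (∀ i, α i) → (I × (∀ i, α i) → ℝ) → ℝ := fun w Θ =>
    if w = v0 then
      prS (jp fun i v => Θ (i, v)) Z v0 * prS (jp fun i v => Θ (i, v)) ({Y} ∪ ({X} ∪ Z)) v0 -
      prS (jp fun i v => Θ (i, v)) ({X} ∪ Z) v0 *
        prS (dj (fun i v => Θ (i, v)) X) ({Y} ∪ ({X} ∪ Z)) v0
    else
      prS (jp fun i v => Θ (i, v)) Z w * prS (jp fun i v => Θ (i, v)) ({X} ∪ Z) v0 -
      prS (jp fun i v => Θ (i, v)) ({X} ∪ Z) w * prS (jp fun i v => Θ (i, v)) Z v0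
  let Cs : Set (I × (∀ i, α i) → ℝ) :=
    {Θ | Mech E (fun i v => Θ (i, v)) ∧ ∀ i v, 0 < Θ (i, v)}
  have hpj : ∀ (S : Set I) (x : ∀ i, α i),
      PolyFn (fun Θ : I × (∀ i, α i) → ℝ => prS (jp fun i v => Θ (i, v)) S x) :=
    fun S x => polyFn_prS polyFn_jp S x
  obtain ⟨Θ, ⟨hm, hp⟩, hF⟩ := generic_point Cs (by
      rintro Θ ⟨h1, h2⟩ Θ' ⟨h1', h2'⟩ s s0 s1
      refine ⟨mech_mix h1 h1' s, fun i v => ?_⟩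
      have a1 := mul_pos (sub_pos.2 s1) (h2 i v)
      have a2 := mul_pos s0 (h2' i v)
      simp only [mix]
      linarith)
    ⟨fun k => θ k.1 k.2, hθ, hpos⟩ F
    (Finset.univ.filter fun w : (∀ i, α i) => ∀ i ∈ Zᶜ, w i = v0 i) (by
      intro w _
      by_cases hw : w = v0
      · simp only [F, hw, if_true]
        exact ((hpj _ _).mul (hpj _ _)).sub ((hpj _ _).mul (polyFn_prS (polyFn_dj X) _ _))
      · simp only [F, hw, if_false]
        exact ((hpj _ _).mul (hpj _ _)).sub ((hpj _ _).mul (hpj _ _))) (by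
      intro w hw
      have hw' : ∀ i ∈ Zᶜ, w i = v0 i := by simpa using hw
      by_cases hwv : w = v0
      · simp only [F, hwv, if_true]
        obtain ⟨θ', h1, h2, h3⟩ := exists_F0 hdag hθ hpos hanc hA hcard v0 hne
        exact ⟨fun k => θ' k.1 k.2, ⟨h1, h2⟩, h3⟩
      · simp only [F, hwv, if_false]
        obtain ⟨θ', h1, h2, h3⟩ := exists_Fw hdag hθ hpos hXZ v0 w hw' hwv hci
        exact ⟨fun k => θ' k.1 k.2, ⟨h1, h2⟩, h3⟩)
  have h0 := hF v0 (by simp)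
  simp only [F, if_true] at h0
  apply h0
  rw [sub_eq_zero]
  refine pole_step hdag hm hp hXZ hYZ hanc hcard hadj v0 ?_
  intro w hw hwv
  have h1 := hF w (by simpa using hw)
  simp only [F, hwv, if_false] at h1
  exact sub_ne_zero.1 h1

lemma prS_insert_subsingleton (p : (∀ i, α i) → ℝ) (k : I) (hk : Fintype.card (α k) ≤ 1)
    (S : Set I) (x : ∀ i, α i) : prS p (insert k S) x = prS p S x := by
  have := Fintype.card_le_one_iff_subsingleton.1 hk
  exact prS_insert_of_zero p S k x fun v hv => absurd (Subsingleton.elim _ _) hv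

lemma mconn_edge {E : I → I → Prop} {X A : I} (h : E A X) :
    MConn E (AncS E ({X} ∪ {A} ∪ ∅)) ∅ X A :=
  Relation.ReflTransGen.single ⟨⟨AncS_self (Or.inl (Or.inl rfl)), AncS_self (Or.inl (Or.inr rfl)),
    Or.inr (Or.inl h)⟩, fun h => h, fun h => h⟩

theorem keyB {E : I → I → Prop} (hdag : Irreflexive (Relation.TransGen E))
    {p : (∀ i, α i) → ℝ} (hpos : ∀ v, 0 < p v)
    (hmarkov : MarkovCompat p E) (hfaith : Faithful p E) {X Y : I} (hXY : X ≠ Y)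
    {Z : Set I} (hXZ : X ∉ Z) (hYZ : Y ∉ Z) (hanc : ∀ z ∈ Z, ¬ Anc E X z)
    (hci : ∀ z ∈ Z, ¬ CondIndep p {X} {z} (Z \ {z}))
    (hadj : IsAdjustmentSet (α := α) E {X} {Y} Z) {A : I} (hA : E A X) (hAZ : A ∉ Z) :
    ¬ MConn E (AncS E ({A} ∪ {Y} ∪ (Z ∪ {X}))) (Z ∪ {X}) A Y := by
  intro hconn
  have hAX : A ≠ X := not_self_edge hdag hA
  have hXA : ¬ CondIndep p {X} {A} ∅ := by
    rw [hfaith {X} {A} ∅ (by simpa using hAX.symm) (by simp)]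
    exact (mconn_iff_not_dsep hdag (by simp) (by simp) hAX.symm).1 (mconn_edge hA)
  have hcard : 1 < Fintype.card (α X) := by
    by_contra h
    apply hXA
    rw [condIndep_iff hpos]
    intro x
    rw [Set.union_assoc, Set.singleton_union, Set.singleton_union (a := X),
      prS_insert_subsingleton p X (by omega), prS_insert_subsingleton p X (by omega)]
    ring
  have key := keyB_analytic hdag (mech_of_markov hdag hpos) (fun i v => condPr_pos hpos _ _ v)
    hXZ hYZ hanc hA hcard hadj (by rw [jp_of_markov hmarkov]; exact hci)
  rw [jp_of_markov hmarkov] at key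
  by_cases hAY : A = Y
  · subst hAY
    have hcardA : 1 < Fintype.card (α A) := by
      by_contra h
      apply hXA
      rw [condIndep_iff hpos]
      intro x
      rw [Set.union_comm {X} {A}, Set.union_assoc, Set.singleton_union, Set.singleton_union (a := A),
        prS_insert_subsingleton p A (by omega), prS_insert_subsingleton p A (by omega)]
    have v0 : ∀ i, α i := fun i => Classical.arbitrary _
    have h1 := key v0
    simp only [Set.singleton_union, Set.insert_idem] at h1
    have h2 := mul_left_cancel₀ (prS_pos hpos _ _).ne' h1
    rw [prS_step p (U := insert X Z) (k := A) (by simp [hAX, hAZ])] at h2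
    obtain ⟨b, hb⟩ := Fintype.exists_ne_of_one_lt_card hcardA (v0 A)
    have h3 := Finset.add_le_sum (s := Finset.univ)
      (f := fun a : α A => prS p (insert A (insert X Z)) (Function.update v0 A a))
      (fun a _ => (prS_pos hpos _ _).le) (Finset.mem_univ b) (Finset.mem_univ (v0 A)) hb
    have h4 := prS_pos hpos (insert A (insert X Z)) (Function.update v0 A b)
    rw [h2] at h3
    simp only [Function.update_eq_self] at h3
    linarith
  · rw [mconn_iff_not_dsep hdag (by simp [hAZ, hAX]) (by simp [hYZ, hXY.symm]) hAY] at hconn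
    apply hconn
    rw [← hfaith {A} {Y} (Z ∪ {X}) (by simpa using hAY) (by
      rw [Set.disjoint_right]
      rintro i (rfl | rfl)
      · simp [hAZ, hAX]
      · simp [hYZ, hXY.symm]), condIndep_iff hpos]
    intro x
    rw [Set.union_comm Z, Set.union_assoc, Set.singleton_union, Set.singleton_union (a := A)]
    exact key x

end KeyD

section Graph

lemma mconn_cut {E : V → V → Prop} {M U : Set V} {X t : V} (hXt : X ≠ t)
    (hM : ∀ c ∈ M, ¬ E X c) (h : MConn E M U X t) :
    ∃ A, E A X ∧ A ∉ U ∧ MConn E M (U ∪ {X}) A t := by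
  have key : ∀ s, MConn E M U s t → (s ≠ X ∧ MConn E M (U ∪ {X}) s t) ∨
      ∃ A, E A X ∧ A ∉ U ∧ MConn E M (U ∪ {X}) A t := by
    intro s hs
    induction hs using Relation.ReflTransGen.head_induction_on with
    | refl => exact Or.inl ⟨hXt.symm, Relation.ReflTransGen.refl⟩
    | @head s c hsc _ ih =>
      rcases ih with ⟨hcX, hc⟩ | h
      · obtain ⟨⟨hsM, hcM, hadj⟩, hsU, hcU⟩ := hsc
        by_cases hsX : s = X
        · subst hsX
          rcases hadj with h | h | ⟨k, hk, h, _⟩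
          · exact absurd h (hM c hcM)
          · exact Or.inr ⟨c, h, hcU, hc⟩
          · exact absurd h (hM k hk)
        · refine Or.inl ⟨hsX, Relation.ReflTransGen.head ⟨⟨hsM, hcM, hadj⟩, ?_, ?_⟩ hc⟩
          · rintro (h | h)
            · exact hsU h
            · exact hsX h
          · rintro (h | h)
            · exact hcU h
            · exact hcX h
      · exact Or.inr h
  rcases key X h with h | h
  · exact absurd rfl h.1
  · exact h

lemma ancS_trans {E : V → V → Prop} {W W' : Set V} (h : ∀ w ∈ W, w ∈ AncS E W') :
    AncS E W ⊆ AncS E W' := by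
  rintro v ⟨w, hw, hv⟩
  obtain ⟨w', hw', h'⟩ := h w hw
  exact ⟨w', hw', Relation.ReflTransGen.trans hv h'⟩

lemma graph_part {E : I → I → Prop} (hdag : Irreflexive (Relation.TransGen E)) {X Y : I}
    {T Z : Set I} (hXT : X ∉ T) (hYT : Y ∉ T) (hanc : ∀ t ∈ T, ¬ Anc E X t)
    (hZT : Z ⊂ T)
    (h1 : ∀ t ∈ T, MConn E (AncS E ({X} ∪ {t} ∪ (T \ {t}))) (T \ {t}) X t)
    (h2 : ∀ t ∈ T, MConn E (AncS E ({Y} ∪ {t} ∪ ((T \ {t}) ∪ {X}))) ((T \ {t}) ∪ {X}) Y t)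
    (hBT : ∀ A, E A X → A ∉ T → ¬ MConn E (AncS E ({A} ∪ {Y} ∪ (T ∪ {X}))) (T ∪ {X}) A Y)
    (hBZ : ∀ A, E A X → A ∉ Z → ¬ MConn E (AncS E ({A} ∪ {Y} ∪ (Z ∪ {X}))) (Z ∪ {X}) A Y) :
    False := by
  set M := AncS E ({X} ∪ {Y} ∪ T) with hM
  have tX : ∀ t ∈ T, t ≠ X := by rintro t ht rfl; exact hXT ht
  have tY : ∀ t ∈ T, t ≠ Y := by rintro t ht rfl; exact hYT ht
  have h1' : ∀ t ∈ T, ∃ A, E A X ∧ A ∉ T \ {t} ∧ MConn E M ((T \ {t}) ∪ {X}) A t := by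
    intro t ht
    obtain ⟨A, hA, hAT, hc⟩ := mconn_cut (tX t ht).symm (by
      rintro c ⟨w, hw, hcw⟩ hXc
      have hXw : Relation.TransGen E X w := Relation.TransGen.head' hXc hcw
      rcases hw with (rfl | rfl) | hw
      · exact hdag _ hXw
      · exact hanc _ ht hXw.to_reflTransGen
      · exact hanc _ hw.1 hXw.to_reflTransGen) (h1 t ht)
    refine ⟨A, hA, hAT, hc.mono (AncS_mono ?_) subset_rfl⟩
    rintro i ((rfl | rfl) | hi)
    · exact Or.inl (Or.inl rfl)
    · exact Or.inr ht
    · exact Or.inr hi.1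
  have h2' : ∀ t ∈ T, MConn E M ((T \ {t}) ∪ {X}) Y t := by
    intro t ht
    refine (h2 t ht).mono (AncS_mono ?_) subset_rfl
    rintro i ((rfl | rfl) | (hi | rfl))
    · exact Or.inl (Or.inr rfl)
    · exact Or.inr ht
    · exact Or.inr hi.1
    · exact Or.inl (Or.inl rfl)
  have hTXY : T ⊆ AncS E ({X} ∪ {Y}) := by
    by_contra hcon
    obtain ⟨t0, ht0, ht0'⟩ := Set.not_subset.1 hcon
    have hwf : WellFounded (fun a b : I => Relation.TransGen E b a) := by
      have i1 : Std.Irrefl (fun a b : I => Relation.TransGen E b a) := ⟨hdag⟩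
      have i2 : IsTrans I (fun a b : I => Relation.TransGen E b a) :=
        ⟨fun a b c h h' => Relation.TransGen.trans h' h⟩
      exact Finite.wellFounded_of_trans_of_irrefl _
    obtain ⟨t, ⟨ht, htn⟩, hmin⟩ := hwf.has_min (T \ AncS E ({X} ∪ {Y})) ⟨t0, ht0, ht0'⟩
    have hnc : ∀ c ∈ M, ¬ E t c := by
      rintro c ⟨w, hw, hcw⟩ htc
      have htw : Relation.TransGen E t w := Relation.TransGen.head' htc hcw
      rcases hw with hw | hw
      · exact htn ⟨w, hw, htw.to_reflTransGen⟩
      · by_cases hwn : w ∈ AncS E ({X} ∪ {Y})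
        · obtain ⟨w', hw', hww⟩ := hwn
          exact htn ⟨w', hw', Relation.ReflTransGen.trans htw.to_reflTransGen hww⟩
        · exact hmin w ⟨hw, hwn⟩ htw
    have hset : (T \ {t}) ∪ {X} ∪ {t} = T ∪ {X} := by
      ext i
      simp only [Set.mem_union, Set.mem_sdiff, Set.mem_singleton_iff]
      by_cases hi : i = t
      · subst hi; simp [ht]
      · simp [hi]
    obtain ⟨A, hA, hAT, hcA⟩ := h1' t ht
    have htA : t ≠ A := by
      rintro rfl
      exact htn ⟨X, Or.inl rfl, Relation.ReflTransGen.single hA⟩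
    obtain ⟨a, hat, haU, hca⟩ := mconn_cut htA hnc hcA.symm
    obtain ⟨b, hbt, hbU, hcb⟩ := mconn_cut (tY t ht) hnc (h2' t ht).symm
    rw [hset] at hca hcb
    have htM : t ∈ M := AncS_self (Or.inr ht)
    have hmem : ∀ a, E a t → a ∉ (T \ {t}) ∪ {X} → a ∉ T ∪ {X} := by
      intro a hat haU h
      rw [← hset] at h
      rcases h with h | h
      · exact haU h
      · exact not_self_edge hdag hat h
    have hstep : MStep E M (T ∪ {X}) a b :=
      ⟨⟨AncS_of_edge hat htM, AncS_of_edge hbt htM, Or.inr (Or.inr ⟨t, htM, hat, hbt⟩)⟩,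
        hmem a hat haU, hmem b hbt hbU⟩
    refine hBT A hA (fun h => hAT ⟨h, fun h' => htA h'.symm⟩) ?_
    refine MConn.mono (M := M) (AncS_mono ?_) subset_rfl
      (Relation.ReflTransGen.trans hca.symm (Relation.ReflTransGen.head hstep hcb))
    rintro i ((rfl | rfl) | hi)
    · exact Or.inr (Or.inr rfl)
    · exact Or.inl (Or.inr rfl)
    · exact Or.inr (Or.inl hi)
  obtain ⟨hsub, hns⟩ := hZT
  obtain ⟨t, ht, htZ⟩ := Set.not_subset.1 hns
  have hZt : Z ⊆ T \ {t} := fun z hz => ⟨hsub hz, by rintro rfl; exact htZ hz⟩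
  obtain ⟨A, hA, hAT, hcA⟩ := h1' t ht
  refine hBZ A hA (fun h => hAT (hZt h)) ?_
  refine MConn.mono (M := M) (ancS_trans ?_) ?_
    (Relation.ReflTransGen.trans hcA (h2' t ht).symm)
  · have hXY' : ∀ i ∈ ({X} ∪ {Y} : Set I), i ∈ ({A} ∪ {Y} ∪ (Z ∪ {X}) : Set I) := by
      rintro i (rfl | rfl)
      · exact Or.inr (Or.inr rfl)
      · exact Or.inl (Or.inr rfl)
    rintro i (hi | hi)
    · exact AncS_self (hXY' i hi)
    · exact AncS_mono hXY' (hTXY hi)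
  · exact Set.union_subset_union_left _ hZt

end Graph

/-- **Probabilistic criteria for minimality (first part).** Given a positive pmf `p`
Markov compatible with and faithful to the DAG `E`, if `T` is an adjustment set
relative to `({X}, {Y})` and `X` is not an ancestor of any vertex of `T`, then `T` is a
minimal adjustment set iff for every `t ∈ T`: `X` and `t` are conditionally dependent
given `T \ {t}`, and `Y` and `t` are conditionally dependent given `(T \ {t}) ∪ {X}`. -/
theorem stmt_10 (E : I → I → Prop)
    (hdag : Irreflexive (Relation.TransGen E))
    (p : (∀ i, α i) → ℝ) (hpmf : IsPMF p) (hpos : ∀ v, 0 < p v)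
    (hmarkov : MarkovCompat p E) (hfaith : Faithful p E)
    (X Y : I) (hXY : X ≠ Y)
    (T : Set I) (hTsub : T ⊆ ({X, Y} : Set I)ᶜ)
    (hanc : ∀ t ∈ T, ¬ Anc E X t)
    (hTadj : IsAdjustmentSet (α := α) E {X} {Y} T) :
    MinimalAdjustmentSet (α := α) E {X} {Y} T ↔
      ∀ t ∈ T, ¬ CondIndep p {X} {t} (T \ {t}) ∧
        ¬ CondIndep p {Y} {t} ((T \ {t}) ∪ {X}) := by
  have hXT : X ∉ T := fun h => hTsub h (Or.inl rfl)
  have hYT : Y ∉ T := fun h => hTsub h (Or.inr rfl)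
  constructor
  · rintro ⟨_, hmin⟩ t ht
    have hss : T \ {t} ⊂ T := ⟨Set.sdiff_subset, fun h => (h ht).2 rfl⟩
    exact ⟨fun h => hmin _ hss (isAdj_remove hdag hfaith hXY hXT hYT ht (Or.inl h) hTadj),
      fun h => hmin _ hss (isAdj_remove hdag hfaith hXY hXT hYT ht (Or.inr h) hTadj)⟩
  · intro hT
    refine ⟨hTadj, fun Z0 hZ0 hZ0adj => ?_⟩
    obtain ⟨Z, ⟨hZT, hZadj⟩, hZmin⟩ := (wellFounded_lt (α := Set I)).has_min
      {Z | Z ⊂ T ∧ IsAdjustmentSet (α := α) E {X} {Y} Z} ⟨Z0, hZ0, hZ0adj⟩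
    have hXZ : X ∉ Z := fun h => hXT (hZT.1 h)
    have hYZ : Y ∉ Z := fun h => hYT (hZT.1 h)
    have hZci : ∀ z ∈ Z, ¬ CondIndep p {X} {z} (Z \ {z}) := by
      intro z hz h
      have hss : Z \ {z} ⊂ Z := ⟨Set.sdiff_subset, fun h => (h hz).2 rfl⟩
      exact hZmin (Z \ {z})
        ⟨hss.trans hZT, isAdj_remove hdag hfaith hXY hXZ hYZ hz (Or.inl h) hZadj⟩ hss
    have conv : ∀ (a t : I) (S : Set I), a ≠ t → a ∉ S → t ∉ S → ¬ CondIndep p {a} {t} S →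
        MConn E (AncS E ({a} ∪ {t} ∪ S)) S a t := by
      intro a t S hat haS htS hci
      rw [hfaith {a} {t} S (by simpa using hat) (by
        rw [Set.disjoint_right]; rintro i (rfl | rfl) <;> assumption)] at hci
      exact (mconn_iff_not_dsep hdag haS htS hat).2 hci
    have tX : ∀ t ∈ T, t ≠ X := by rintro t ht rfl; exact hXT ht
    have tY : ∀ t ∈ T, t ≠ Y := by rintro t ht rfl; exact hYT ht
    refine graph_part hdag hXT hYT hanc hZT ?_ ?_ ?_ ?_
    · intro t ht
      exact conv X t _ (tX t ht).symm (fun h => hXT h.1) (by simp) (hT t ht).1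
    · intro t ht
      exact conv Y t _ (tY t ht).symm (by simp [hYT, hXY.symm]) (by simp [tX t ht]) (hT t ht).2
    · intro A hA hAT
      exact keyB hdag hpos hmarkov hfaith hXY hXT hYT hanc (fun t ht => (hT t ht).1) hTadj hA hAT
    · intro A hA hAZ
      exact keyB hdag hpos hmarkov hfaith hXY hXZ hYZ (fun z hz => hanc z (hZT.1 hz)) hZci hZadj
        hA hAZ
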